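/- arXiv:1112.3468 — 10 statements merged into one kernel-verified Lean document; each statement's English description precedes it below -/
import Mathlib

section
/- Let K ≥ 1 be a real number, let A ⊆ ℝ be a finite set of size n ≥ 1, and suppose that for each a ∈ A we are given a map φ_a : A → ℝ such that: (i) φ_a is injective; (ii) φ_a(a) = a; (iii) |a − φ_a(x)| ≤ (1/K)|a − x| for all x ∈ A; (iv) φ_a(x) lies between a and x, i.e. min(a,x) ≤ φ_a(x) ≤ max(a,x) for all x ∈ A. Then the cardinality of the union ⋃_{a ∈ A} φ_a(A) is at least (1/8)·K·n·(1 − n^{−1/K²}). -/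
/-- A Bernoulli-type bound comparing the power of a part with the power of the whole. -/
theorem mul_rpow_neg_le_add_mul_rpow_neg {x y δ : ℝ} (hx : 0 < x) (hy : 0 ≤ y)
    (hδ0 : 0 ≤ δ) (hδ1 : δ ≤ 1) :
    x * x ^ (-δ) ≤ (x + δ * y) * (x + y) ^ (-δ) := by
  have hxy : 0 < x + y := by linarith
  have hbern : (1 + y / x) ^ δ ≤ 1 + δ * (y / x) :=
    rpow_one_add_le_one_add_mul_self (by linarith [div_nonneg hy hx.le]) hδ0 hδ1
  have hx1 : 1 + y / x = (x + y) / x := by field_simp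
  rw [hx1, Real.div_rpow hxy.le hx.le] at hbern
  have hpx : 0 < x ^ δ := Real.rpow_pos_of_pos hx δ
  have hpxy : 0 < (x + y) ^ δ := Real.rpow_pos_of_pos hxy δ
  rw [Real.rpow_neg hx.le, Real.rpow_neg hxy.le, ← div_eq_mul_inv, ← div_eq_mul_inv,
    div_le_div_iff₀ hpx hpxy]
  have h := (div_le_iff₀ hpx).1 hbern
  have h' := mul_le_mul_of_nonneg_left h hx.le
  have : x * ((1 + δ * (y / x)) * x ^ δ) = (x + δ * y) * x ^ δ := by field_simp
  linarith

/-- The lower bound grows by at most the larger part when two sets are merged. -/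
theorem expansion_bound_add_le {K x y g : ℝ} (hK : 1 ≤ K) (hx : 1 ≤ x) (hy : 1 ≤ y)
    (hxg : x ≤ g) (hyg : y ≤ g) :
    (1 / 8) * K * (x + y) * (1 - (x + y) ^ (-(1 / K ^ 2))) ≤
      (1 / 8) * K * x * (1 - x ^ (-(1 / K ^ 2))) +
        (1 / 8) * K * y * (1 - y ^ (-(1 / K ^ 2))) + g := by
  have hK0 : 0 < K := by linarith
  set δ : ℝ := 1 / K ^ 2 with hδ
  have hδ0 : 0 ≤ δ := by positivity
  have hδ1 : δ ≤ 1 := by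
    rw [hδ, div_le_one (by positivity)]
    nlinarith
  have hKδ : K * δ ≤ 1 := by
    have : K * δ = 1 / K := by rw [hδ]; field_simp
    rw [this, div_le_one hK0]
    exact hK
  have h1 := mul_rpow_neg_le_add_mul_rpow_neg (x := x) (y := y) (by linarith) (by linarith) hδ0 hδ1
  have h2 := mul_rpow_neg_le_add_mul_rpow_neg (x := y) (y := x) (by linarith) (by linarith) hδ0 hδ1
  rw [add_comm y x] at h2
  have hle : (x + y) ^ (-δ) ≤ 1 :=
    Real.rpow_le_one_of_one_le_of_nonpos (by linarith) (by linarith)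
  have h3 : δ * (x + y) * (x + y) ^ (-δ) ≤ δ * (x + y) :=
    mul_le_of_le_one_right (by nlinarith) hle
  have h4 : x * x ^ (-δ) + y * y ^ (-δ) - (x + y) * (x + y) ^ (-δ) ≤ δ * (x + y) := by
    linarith
  have h5 := mul_le_mul_of_nonneg_left h4 hK0.le
  have h6 : K * δ * (x + y) ≤ x + y := mul_le_of_le_one_left (by linarith) hKδ
  linarith

/-- If `A` meets every interval of length `L / K` starting inside its range, where `L` is its
diameter, then the union of the images has at least `⌊K / 3⌋₊ * #A` elements. -/
theorem floor_mul_card_le_card_biUnion_image {K l u : ℝ} (hK : 0 < K) {A : Finset ℝ}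
    {φ : ℝ → ℝ → ℝ} (hlu : l < u) (hl : ∀ x ∈ A, l ≤ x) (hu : ∀ x ∈ A, x ≤ u)
    (hinj : ∀ a ∈ A, Set.InjOn (φ a) (A : Set ℝ))
    (hcontract : ∀ a ∈ A, ∀ x ∈ A, |a - φ a x| ≤ (1 / K) * |a - x|)
    (hdense : ∀ y, l < y → y ≤ u → ∃ a ∈ A, y ≤ a ∧ a < y + (u - l) / K) :
    ⌊K / 3⌋₊ * A.card ≤ (A.biUnion fun a => A.image (φ a)).card := by
  classical
  set d : ℝ := (u - l) / K with hd
  have hd0 : 0 < d := div_pos (by linarith) hK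
  have hKd : K * d = u - l := by rw [hd]; field_simp
  have hcell : ∀ i : ℕ, ∃ a, i < ⌊K / 3⌋₊ →
      a ∈ A ∧ l + (3 * i + 1) * d ≤ a ∧ a < l + (3 * i + 2) * d := by
    intro i
    by_cases hi : i < ⌊K / 3⌋₊
    · have h1 : ((i + 1 : ℕ) : ℝ) ≤ K / 3 := (Nat.le_floor_iff (by positivity)).1 hi
      push_cast at h1
      have h2 : (3 * (i : ℝ) + 1) * d ≤ K * d :=
        mul_le_mul_of_nonneg_right (by linarith) hd0.le
      obtain ⟨a, ha, h3, h4⟩ := hdense (l + (3 * i + 1) * d)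
        (by have : 0 < (3 * (i : ℝ) + 1) * d := by positivity
            linarith) (by linarith)
      exact ⟨a, fun _ => ⟨ha, h3, by linarith⟩⟩
    · exact ⟨0, fun h => absurd h hi⟩
  choose c hc using hcell
  have hmem : ∀ i < ⌊K / 3⌋₊, ∀ z ∈ A.image (φ (c i)),
      l + 3 * i * d ≤ z ∧ z < l + (3 * i + 3) * d := by
    intro i hi z hz
    obtain ⟨x, hx, rfl⟩ := Finset.mem_image.1 hz
    obtain ⟨ha, h1, h2⟩ := hc i hi
    have hax : |c i - x| ≤ u - l := by
      rw [abs_le]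
      constructor <;> linarith [hl x hx, hu x hx, hl _ ha, hu _ ha]
    have h3 : |c i - φ (c i) x| ≤ d := by
      refine (hcontract _ ha x hx).trans ?_
      rw [hd, one_div, div_eq_inv_mul]
      exact mul_le_mul_of_nonneg_left hax (by positivity)
    rw [abs_le] at h3
    constructor <;> linarith
  have hdisj : ∀ i j : ℕ, i < j → j < ⌊K / 3⌋₊ →
      Disjoint (A.image (φ (c i))) (A.image (φ (c j))) := by
    intro i j hij hj
    rw [Finset.disjoint_left]
    intro z hz1 hz2
    have h1 := (hmem i (hij.trans hj) z hz1).2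
    have h2 := (hmem j hj z hz2).1
    have h3 : (i : ℝ) + 1 ≤ j := by exact_mod_cast hij
    have h4 := mul_le_mul_of_nonneg_right h3 hd0.le
    linarith
  calc ⌊K / 3⌋₊ * A.card
      = ((Finset.range ⌊K / 3⌋₊).biUnion fun i => A.image (φ (c i))).card := by
        rw [Finset.card_biUnion]
        · rw [Finset.sum_congr rfl fun i hi => Finset.card_image_of_injOn
            (hinj _ (hc i (Finset.mem_range.1 hi)).1)]
          simp
        · intro i hi j hj hij
          rcases lt_or_gt_of_ne hij with h | h
          · exact hdisj i j h (Finset.mem_range.1 hj)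
          · exact (hdisj j i h (Finset.mem_range.1 hi)).symm
    _ ≤ _ := by
        refine Finset.card_le_card fun z hz => ?_
        obtain ⟨i, hi, hz⟩ := Finset.mem_biUnion.1 hz
        exact Finset.mem_biUnion.2 ⟨c i, (hc i (Finset.mem_range.1 hi)).1, hz⟩

/-- Splitting a set at a gap wider than `1 / K` times its diameter: the images of the two sides
are counted separately, and the gap holds as many further points as either side has. -/
theorem card_biUnion_image_split {K l u y : ℝ} (hK : 0 < K) {A : Finset ℝ} {φ : ℝ → ℝ → ℝ}
    (hlA : l ∈ A) (huA : u ∈ A) (hl : ∀ x ∈ A, l ≤ x) (hu : ∀ x ∈ A, x ≤ u)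
    (hinj : ∀ a ∈ A, Set.InjOn (φ a) (A : Set ℝ))
    (hfix : ∀ a ∈ A, φ a a = a)
    (hcontract : ∀ a ∈ A, ∀ x ∈ A, |a - φ a x| ≤ (1 / K) * |a - x|)
    (hbetween : ∀ a ∈ A, ∀ x ∈ A, min a x ≤ φ a x ∧ φ a x ≤ max a x)
    (hly : l < y) (hyu : y ≤ u) (hgap : ∀ a ∈ A, y ≤ a → y + (u - l) / K ≤ a) :
    ((A.filter (· < y)).biUnion fun a => (A.filter (· < y)).image (φ a)).card +
      ((A.filter (y ≤ ·)).biUnion fun a => (A.filter (y ≤ ·)).image (φ a)).card +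
      max (A.filter (· < y)).card (A.filter (y ≤ ·)).card ≤
      (A.biUnion fun a => A.image (φ a)).card := by
  classical
  set B := A.filter (· < y) with hB
  set C := A.filter (y ≤ ·) with hC
  have hBm : ∀ x, x ∈ B ↔ x ∈ A ∧ x < y := fun x => Finset.mem_filter
  have hCm : ∀ x, x ∈ C ↔ x ∈ A ∧ y ≤ x := fun x => Finset.mem_filter
  have hBne : B.Nonempty := ⟨l, (hBm l).2 ⟨hlA, hly⟩⟩
  have hCne : C.Nonempty := ⟨u, (hCm u).2 ⟨huA, hyu⟩⟩
  obtain ⟨a, haB, ha⟩ := B.exists_max_image id hBne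
  obtain ⟨b, hbC, hb⟩ := C.exists_min_image id hCne
  simp only [id] at ha hb
  obtain ⟨haA, hay⟩ := (hBm a).1 haB
  obtain ⟨hbA, hyb⟩ := (hCm b).1 hbC
  have hab : a + (u - l) / K < b := by linarith [hgap b hbA hyb]
  set U := A.biUnion fun a => A.image (φ a) with hU
  have hmemU : ∀ s ∈ A, ∀ t ∈ A, φ s t ∈ U := fun s hs t ht =>
    Finset.mem_biUnion.2 ⟨s, hs, Finset.mem_image_of_mem _ ht⟩
  have hBU : (B.biUnion fun a => B.image (φ a)) ⊆ U.filter (· ≤ a) := by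
    intro z hz
    obtain ⟨s, hs, hz⟩ := Finset.mem_biUnion.1 hz
    obtain ⟨t, ht, rfl⟩ := Finset.mem_image.1 hz
    have hs' := ((hBm s).1 hs).1
    have ht' := ((hBm t).1 ht).1
    exact Finset.mem_filter.2 ⟨hmemU s hs' t ht',
      (hbetween s hs' t ht').2.trans (max_le (ha s hs) (ha t ht))⟩
  have hCU : (C.biUnion fun a => C.image (φ a)) ⊆ U.filter (b ≤ ·) := by
    intro z hz
    obtain ⟨s, hs, hz⟩ := Finset.mem_biUnion.1 hz
    obtain ⟨t, ht, rfl⟩ := Finset.mem_image.1 hz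
    have hs' := ((hCm s).1 hs).1
    have ht' := ((hCm t).1 ht).1
    exact Finset.mem_filter.2 ⟨hmemU s hs' t ht',
      (le_min (hb s hs) (hb t ht)).trans (hbetween s hs' t ht').1⟩
  have hdist : ∀ s ∈ A, ∀ t ∈ A, |s - φ s t| ≤ (u - l) / K := by
    intro s hs t ht
    have hst : |s - t| ≤ u - l := by
      rw [abs_le]
      constructor <;> linarith [hl s hs, hu s hs, hl t ht, hu t ht]
    refine (hcontract s hs t ht).trans ?_
    rw [one_div, div_eq_inv_mul]
    exact mul_le_mul_of_nonneg_left hst (by positivity)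
  have hne : ∀ s ∈ A, ∀ t ∈ A, t ≠ s → φ s t ≠ s := fun s hs t ht hts h =>
    hts (hinj s hs ht hs (h.trans (hfix s hs).symm))
  have hCG : C.card ≤ (U.filter fun z => a < z ∧ z < b).card := by
    refine Finset.card_le_card_of_injOn (φ a) (fun x hx => ?_)
      ((hinj a haA).mono fun x hx => ((hCm x).1 hx).1)
    obtain ⟨hxA, hyx⟩ := (hCm x).1 hx
    have hax : a < x := hay.trans_le hyx
    have h1 := (hbetween a haA x hxA).1
    rw [min_eq_left hax.le] at h1
    have h2 := (abs_le.1 (hdist a haA x hxA)).1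
    exact Finset.mem_coe.2 <| Finset.mem_filter.2 ⟨hmemU a haA x hxA,
      lt_of_le_of_ne h1 (hne a haA x hxA hax.ne').symm, by linarith⟩
  have hBG : B.card ≤ (U.filter fun z => a < z ∧ z < b).card := by
    refine Finset.card_le_card_of_injOn (φ b) (fun x hx => ?_)
      ((hinj b hbA).mono fun x hx => ((hBm x).1 hx).1)
    obtain ⟨hxA, hyx⟩ := (hBm x).1 hx
    have hxb : x < b := hyx.trans_le hyb
    have h1 := (hbetween b hbA x hxA).2
    rw [max_eq_left hxb.le] at h1
    have h2 := (abs_le.1 (hdist b hbA x hxA)).2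
    exact Finset.mem_coe.2 <| Finset.mem_filter.2 ⟨hmemU b hbA x hxA,
      by linarith, lt_of_le_of_ne h1 (hne b hbA x hxA hxb.ne)⟩
  have hab' : a < b := hay.trans_le hyb
  have hdisj₁ : Disjoint (U.filter (· ≤ a)) (U.filter (b ≤ ·)) := by
    rw [Finset.disjoint_filter]
    intro z _ h1 h2
    linarith
  have hdisj₂ : Disjoint (U.filter (· ≤ a) ∪ U.filter (b ≤ ·))
      (U.filter fun z => a < z ∧ z < b) := by
    rw [← Finset.filter_or, Finset.disjoint_filter]
    rintro z _ (h1 | h1) ⟨h2, h3⟩ <;> linarith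
  calc _ ≤ (U.filter (· ≤ a)).card + (U.filter (b ≤ ·)).card +
        (U.filter fun z => a < z ∧ z < b).card :=
        add_le_add (add_le_add (Finset.card_le_card hBU) (Finset.card_le_card hCU))
          (max_le hBG hCG)
    _ = (U.filter (· ≤ a) ∪ U.filter (b ≤ ·) ∪ U.filter fun z => a < z ∧ z < b).card := by
        rw [Finset.card_union_of_disjoint hdisj₂, Finset.card_union_of_disjoint hdisj₁]
    _ ≤ U.card := Finset.card_le_card <| Finset.union_subset
        (Finset.union_subset (Finset.filter_subset _ _) (Finset.filter_subset _ _))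
        (Finset.filter_subset _ _)

/-- The linear bound `K * #A / 8` when `A` has no gap wider than `1 / K` times its diameter. -/
theorem mul_card_div_eight_le_card_biUnion_image {K l u : ℝ} {A : Finset ℝ}
    {φ : ℝ → ℝ → ℝ} (hlu : l < u) (hl : ∀ x ∈ A, l ≤ x) (hu : ∀ x ∈ A, x ≤ u)
    (hinj : ∀ a ∈ A, Set.InjOn (φ a) (A : Set ℝ))
    (hfix : ∀ a ∈ A, φ a a = a)
    (hcontract : ∀ a ∈ A, ∀ x ∈ A, |a - φ a x| ≤ (1 / K) * |a - x|)
    (hdense : ∀ y, l < y → y ≤ u → ∃ a ∈ A, y ≤ a ∧ a < y + (u - l) / K) :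
    (1 / 8) * K * A.card ≤ ((A.biUnion fun a => A.image (φ a)).card : ℝ) := by
  have hn : (0 : ℝ) ≤ A.card := Nat.cast_nonneg _
  rcases lt_or_ge K 3 with h | h
  · have hsub : A ⊆ A.biUnion fun a => A.image (φ a) := fun a ha =>
      Finset.mem_biUnion.2 ⟨a, ha, Finset.mem_image.2 ⟨a, ha, hfix a ha⟩⟩
    have h1 : (A.card : ℝ) ≤ ((A.biUnion fun a => A.image (φ a)).card : ℝ) := by
      exact_mod_cast Finset.card_le_card hsub
    nlinarith
  · have h1 : ((⌊K / 3⌋₊ * A.card : ℕ) : ℝ) ≤ ((A.biUnion fun a => A.image (φ a)).card : ℝ) := by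
      exact_mod_cast floor_mul_card_le_card_biUnion_image (by linarith) hlu hl hu hinj
        hcontract hdense
    push_cast at h1
    have h2 : K / 3 < ⌊K / 3⌋₊ + 1 := Nat.lt_floor_add_one _
    have h3 : (1 : ℝ) ≤ ⌊K / 3⌋₊ := by
      exact_mod_cast (Nat.one_le_floor_iff _).2 (by linarith : 1 ≤ K / 3)
    have h4 : (1 / 8) * K ≤ ⌊K / 3⌋₊ := by linarith
    exact (mul_le_mul_of_nonneg_right h4 hn).trans h1


/-- Main theorem: if `A ⊆ ℝ` is finite of size `n ≥ 1` and for each `a ∈ A` we have an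
injective map `φ a : A → ℝ` fixing `a`, contracting every point of `A` towards `a` by a
factor `K`, and never moving a point past `a` (betweenness), then the union of the
images `φ a '' A` has at least `(1/8)·K·n·(1 − n^{−1/K²})` elements. -/
theorem contractions_expansion_main
    (K : ℝ) (hK : 1 ≤ K) (A : Finset ℝ) (n : ℕ) (hn : A.card = n) (hn1 : 1 ≤ n)
    (φ : ℝ → ℝ → ℝ)
    (hinj : ∀ a ∈ A, Set.InjOn (φ a) (A : Set ℝ))
    (hfix : ∀ a ∈ A, φ a a = a)
    (hcontract : ∀ a ∈ A, ∀ x ∈ A, |a - φ a x| ≤ (1 / K) * |a - x|)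
    (hbetween : ∀ a ∈ A, ∀ x ∈ A, min a x ≤ φ a x ∧ φ a x ≤ max a x) :
    (((A.biUnion fun a => A.image (φ a)).card : ℝ)) ≥
      (1 / 8) * K * n * (1 - (n : ℝ) ^ (-(1 / K ^ 2))) := by
  subst hn
  induction A using Finset.strongInduction with
  | H A ih =>
    have hne : A.Nonempty := Finset.card_pos.1 hn1
    obtain ⟨l, hlA, hl⟩ := A.exists_min_image id hne
    obtain ⟨u, huA, hu⟩ := A.exists_max_image id hne
    simp only [id] at hl hu
    rcases (hl u huA).eq_or_lt with heq | hlu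
    · have hcard : A.card = 1 := Finset.card_eq_one.2 ⟨l, Finset.eq_singleton_iff_unique_mem.2
        ⟨hlA, fun x hx => le_antisymm (heq ▸ hu x hx) (hl x hx)⟩⟩
      rw [hcard]
      simp
    by_cases hdense : ∀ y, l < y → y ≤ u → ∃ a ∈ A, y ≤ a ∧ a < y + (u - l) / K
    · have h1 := mul_card_div_eight_le_card_biUnion_image hlu hl hu hinj hfix hcontract hdense
      refine le_trans (mul_le_of_le_one_right (by positivity) ?_) h1
      linarith [Real.rpow_nonneg (Nat.cast_nonneg (α := ℝ) A.card) (-(1 / K ^ 2))]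
    · push Not at hdense
      obtain ⟨y, hly, hyu, hgap⟩ := hdense
      have hsplit := card_biUnion_image_split (by linarith) hlA huA hl hu hinj hfix hcontract
        hbetween hly hyu hgap
      have hsum : (A.filter (· < y)).card + (A.filter (y ≤ ·)).card = A.card := by
        simpa only [not_lt] using Finset.card_filter_add_card_filter_not (s := A) (· < y)
      have hB : 1 ≤ (A.filter (· < y)).card :=
        Finset.card_pos.2 ⟨l, Finset.mem_filter.2 ⟨hlA, hly⟩⟩
      have hC : 1 ≤ (A.filter (y ≤ ·)).card :=
        Finset.card_pos.2 ⟨u, Finset.mem_filter.2 ⟨huA, hyu⟩⟩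
      have hrec : ∀ B ⊂ A, 1 ≤ B.card →
          ((B.biUnion fun a => B.image (φ a)).card : ℝ) ≥
            (1 / 8) * K * B.card * (1 - (B.card : ℝ) ^ (-(1 / K ^ 2))) := fun B hBA hB1 =>
        ih B hBA (fun a ha => (hinj a (hBA.1 ha)).mono (Finset.coe_subset.2 hBA.1))
          (fun a ha => hfix a (hBA.1 ha))
          (fun a ha x hx => hcontract a (hBA.1 ha) x (hBA.1 hx))
          (fun a ha x hx => hbetween a (hBA.1 ha) x (hBA.1 hx)) hB1
      have hrecB := hrec (A.filter (· < y)) (Finset.filter_ssubset.2 ⟨u, huA, not_lt.2 hyu⟩) hB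
      have hrecC := hrec (A.filter (y ≤ ·)) (Finset.filter_ssubset.2 ⟨l, hlA, not_le.2 hly⟩) hC
      have hbound := expansion_bound_add_le hK
        (x := ((A.filter (· < y)).card : ℝ)) (y := ((A.filter (y ≤ ·)).card : ℝ))
        (g := ((max (A.filter (· < y)).card (A.filter (y ≤ ·)).card : ℕ) : ℝ))
        (by exact_mod_cast hB) (by exact_mod_cast hC)
        (by exact_mod_cast le_max_left _ _) (by exact_mod_cast le_max_right _ _)
      have hsplit' := (Nat.cast_le (α := ℝ)).2 hsplit
      rw [← Nat.cast_add, hsum] at hbound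
      rw [Nat.cast_add, Nat.cast_add] at hsplit'
      linarith
end

section
/- Let K ≥ 1 be a real number and let A ⊆ ℝ be a finite set of size n ≥ 1. Then |A + K·A| ≥ (1/8)·K·n·(1 − n^{−1/K²}), where A + K·A := {a + K·a' : a, a' ∈ A}. -/
/-- The sumset `A + K·A`. -/
noncomputable def sumDilate (K : ℝ) (A : Finset ℝ) : Finset ℝ :=
  (A ×ˢ A).image fun p => p.1 + K * p.2

theorem mem_sumDilate {K : ℝ} {A : Finset ℝ} {x : ℝ} :
    x ∈ sumDilate K A ↔ ∃ a ∈ A, ∃ b ∈ A, a + K * b = x := by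
  simp [sumDilate, and_assoc]

/-- If all gaps of `A ⊆ [m, M]` are smaller than `(M - m) / K`, there are many disjoint translates
of `A` in `A + K·A`. -/
theorem exists_many_translates {K m M : ℝ} {A : Finset ℝ}
    (hm : m ∈ A) (hmA : ∀ a ∈ A, m ≤ a) (hM : M ∈ A) (hMA : ∀ a ∈ A, a ≤ M) (hmM : m < M)
    (hgap : ∀ a ∈ A, a < M → ∃ b ∈ A, a < b ∧ K * (b - a) < M - m)
    (j : ℕ) (hj : 2 * (j : ℝ) < K + 1) :
    ∃ x ∈ A, K * (x - m) ≤ 2 * j * (M - m) ∧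
      (j + 1) * A.card ≤ ((sumDilate K A).filter (· ≤ M + K * x)).card := by
  induction j with
  | zero =>
    refine ⟨m, hm, by simp, ?_⟩
    rw [zero_add, one_mul, ← Finset.card_image_of_injective A (add_left_injective (K * m))]
    refine Finset.card_le_card fun y hy => ?_
    obtain ⟨a, ha, rfl⟩ := Finset.mem_image.1 hy
    exact Finset.mem_filter.2 ⟨mem_sumDilate.2 ⟨a, ha, m, hm, rfl⟩, by linarith [hMA a ha]⟩
  | succ j ih =>
    push_cast at hj
    obtain ⟨x, hx, hxm, hcard⟩ := ih (by linarith)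
    have hxM : M - m < K * (M - x) := by nlinarith
    have hne : (A.filter fun z => K * (z - x) ≤ M - m).Nonempty :=
      ⟨x, Finset.mem_filter.2 ⟨hx, by simpa using hmM.le⟩⟩
    obtain ⟨z, hz, hzmax⟩ := Finset.exists_max_image _ id hne
    obtain ⟨hzA, hzx⟩ := Finset.mem_filter.1 hz
    have hzM : z < M := lt_of_le_of_ne (hMA z hzA) (by rintro rfl; linarith)
    obtain ⟨b, hbA, hzb, hb⟩ := hgap z hzA hzM
    have hbx : M - m < K * (b - x) := by
      by_contra! h
      have := hzmax b (Finset.mem_filter.2 ⟨hbA, h⟩)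
      simp only [id] at this
      linarith
    refine ⟨b, hbA, by push_cast; linarith, ?_⟩
    have hdisj : Disjoint ((sumDilate K A).filter (· ≤ M + K * x)) (A.image (· + K * b)) := by
      refine Finset.disjoint_left.2 fun y hy hy' => ?_
      obtain ⟨a, ha, rfl⟩ := Finset.mem_image.1 hy'
      have := (Finset.mem_filter.1 hy).2
      linarith [hmA a ha]
    calc (j + 1 + 1) * A.card = (j + 1) * A.card + (A.image (· + K * b)).card := by
          rw [Finset.card_image_of_injective A (add_left_injective (K * b))]; ring
      _ ≤ ((sumDilate K A).filter (· ≤ M + K * x)).card + (A.image (· + K * b)).card := by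
          gcongr
      _ = _ := (Finset.card_union_of_disjoint hdisj).symm
      _ ≤ _ := by
          refine Finset.card_le_card fun y hy => ?_
          rcases Finset.mem_union.1 hy with hy | hy
          · obtain ⟨h1, h2⟩ := Finset.mem_filter.1 hy
            exact Finset.mem_filter.2 ⟨h1, by linarith⟩
          · obtain ⟨a, ha, rfl⟩ := Finset.mem_image.1 hy
            exact Finset.mem_filter.2
              ⟨mem_sumDilate.2 ⟨a, ha, b, hbA, rfl⟩, by linarith [hMA a ha]⟩

theorem half_mul_card_le_card_sumDilate {K m M : ℝ} {A : Finset ℝ} (hK : 1 ≤ K)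
    (hm : m ∈ A) (hmA : ∀ a ∈ A, m ≤ a) (hM : M ∈ A) (hMA : ∀ a ∈ A, a ≤ M) (hmM : m < M)
    (hgap : ∀ a ∈ A, a < M → ∃ b ∈ A, a < b ∧ K * (b - a) < M - m) :
    K / 2 * A.card ≤ (sumDilate K A).card := by
  have hfloor := Nat.floor_le (show 0 ≤ K / 2 by linarith)
  obtain ⟨x, -, -, h⟩ := exists_many_translates hm hmA hM hMA hmM hgap ⌊K / 2⌋₊ (by linarith)
  have h' : ((⌊K / 2⌋₊ + 1 : ℝ)) * A.card ≤ (sumDilate K A).card := by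
    exact_mod_cast h.trans (Finset.card_filter_le _ _)
  refine le_trans ?_ h'
  gcongr
  exact (Nat.lt_floor_add_one _).le

/-- Cutting `A` at a gap `(u, v)` of length at least `(M - m) / K` gains `max (|A₁|, |A₂|)`
elements of `A + K·A` lying between `A₁ + K·A₁` and `A₂ + K·A₂`. -/
theorem card_sumDilate_of_large_gap {K m M u v : ℝ} {A : Finset ℝ} (hK : 1 ≤ K)
    (hmA : ∀ a ∈ A, m ≤ a) (hMA : ∀ a ∈ A, a ≤ M)
    (hu : u ∈ A) (hv : v ∈ A) (huv : u < v) (hcut : ∀ a ∈ A, u < a → v ≤ a)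
    (hgap : M - m ≤ K * (v - u)) :
    (sumDilate K (A.filter (· ≤ u))).card + (sumDilate K (A.filter (¬ · ≤ u))).card +
      max (A.filter (· ≤ u)).card (A.filter (¬ · ≤ u)).card ≤ (sumDilate K A).card := by
  have hum := hmA u hu
  have hvM := hMA v hv
  have key : ∀ G ⊆ sumDilate K A, (∀ g ∈ G, u + K * u < g ∧ g < v + K * v) →
      (sumDilate K (A.filter (· ≤ u))).card + (sumDilate K (A.filter (¬ · ≤ u))).card +
        G.card ≤ (sumDilate K A).card := by
    intro G hG hGb
    have hlow : ∀ y ∈ sumDilate K (A.filter (· ≤ u)), y ∈ sumDilate K A ∧ y ≤ u + K * u := by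
      intro y hy
      obtain ⟨a, ha, b, hb, rfl⟩ := mem_sumDilate.1 hy
      rw [Finset.mem_filter] at ha hb
      exact ⟨mem_sumDilate.2 ⟨a, ha.1, b, hb.1, rfl⟩, by nlinarith⟩
    have hhigh : ∀ y ∈ sumDilate K (A.filter (¬ · ≤ u)), y ∈ sumDilate K A ∧ v + K * v ≤ y := by
      intro y hy
      obtain ⟨a, ha, b, hb, rfl⟩ := mem_sumDilate.1 hy
      rw [Finset.mem_filter, not_le] at ha hb
      exact ⟨mem_sumDilate.2 ⟨a, ha.1, b, hb.1, rfl⟩,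
        by nlinarith [hcut a ha.1 ha.2, hcut b hb.1 hb.2]⟩
    have huvK : u + K * u < v + K * v := by nlinarith
    have h1 : Disjoint (sumDilate K (A.filter (· ≤ u))) (sumDilate K (A.filter (¬ · ≤ u))) :=
      Finset.disjoint_left.2 fun y hy hy' => by linarith [(hlow y hy).2, (hhigh y hy').2]
    have h2 : Disjoint (sumDilate K (A.filter (· ≤ u)) ∪ sumDilate K (A.filter (¬ · ≤ u))) G :=
      Finset.disjoint_left.2 fun y hy hy' => by
        rcases Finset.mem_union.1 hy with hy | hy
        · linarith [(hlow y hy).2, (hGb y hy').1]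
        · linarith [(hhigh y hy).2, (hGb y hy').2]
    rw [← Finset.card_union_of_disjoint h1, ← Finset.card_union_of_disjoint h2]
    exact Finset.card_le_card (Finset.union_subset (Finset.union_subset
      (fun y hy => (hlow y hy).1) (fun y hy => (hhigh y hy).1)) hG)
  rcases max_choice (A.filter (· ≤ u)).card (A.filter (¬ · ≤ u)).card with h | h <;> rw [h]
  · rw [← Finset.card_image_of_injective (A.filter (· ≤ u)) (add_left_injective (K * v))]
    refine key _ (fun y hy => ?_) (fun y hy => ?_) <;>
      obtain ⟨a, ha, rfl⟩ := Finset.mem_image.1 hy <;> rw [Finset.mem_filter] at ha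
    · exact mem_sumDilate.2 ⟨a, ha.1, v, hv, rfl⟩
    · constructor <;> linarith [hmA a ha.1]
  · rw [← Finset.card_image_of_injective (A.filter (¬ · ≤ u)) (add_left_injective (K * u))]
    refine key _ (fun y hy => ?_) (fun y hy => ?_) <;>
      obtain ⟨a, ha, rfl⟩ := Finset.mem_image.1 hy <;> rw [Finset.mem_filter, not_le] at ha
    · exact mem_sumDilate.2 ⟨a, ha.1, u, hu, rfl⟩
    · constructor <;> linarith [hMA a ha.1]

theorem mul_rpow_neg_sub_le {x N ε : ℝ} (hx : 0 < x) (hN : 1 ≤ N) (hxN : x ≤ N) (hε : 0 ≤ ε)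
    (hε1 : ε ≤ 1) : x * (x ^ (-ε) - N ^ (-ε)) ≤ ε * (N - x) := by
  have hN0 : 0 < N := by linarith
  have hbern : (N / x) ^ ε ≤ 1 + ε * (N / x - 1) := by
    have h := rpow_one_add_le_one_add_mul_self (s := N / x - 1) (p := ε)
      (by linarith [div_nonneg hN0.le hx.le]) hε hε1
    simpa using h
  have hpow : x ^ (-ε) = N ^ (-ε) * (N / x) ^ ε := by
    rw [Real.div_rpow hN0.le hx.le, Real.rpow_neg hx.le, Real.rpow_neg hN0.le]
    have := (Real.rpow_pos_of_pos hN0 ε).ne'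
    have := (Real.rpow_pos_of_pos hx ε).ne'
    field_simp
  have hN1 : N ^ (-ε) ≤ 1 := Real.rpow_le_one_of_one_le_of_nonpos hN (by linarith)
  have hxN' : x * (N / x - 1) = N - x := by field_simp
  calc x * (x ^ (-ε) - N ^ (-ε)) = N ^ (-ε) * (x * ((N / x) ^ ε - 1)) := by rw [hpow]; ring
    _ ≤ N ^ (-ε) * (x * (ε * (N / x - 1))) := by
        have := (Real.rpow_pos_of_pos hN0 (-ε)).le
        gcongr
        linarith
    _ = N ^ (-ε) * (ε * (N - x)) := by rw [← hxN']; ring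
    _ ≤ 1 * (ε * (N - x)) := by
        have : 0 ≤ N - x := by linarith
        gcongr
    _ = ε * (N - x) := one_mul _

theorem lower_bound_add_le {K x y : ℝ} (hK : 1 ≤ K) (hx : 1 ≤ x) (hy : 1 ≤ y) :
    1 / 8 * K * (x + y) * (1 - (x + y) ^ (-(1 / K ^ 2))) ≤
      1 / 8 * K * x * (1 - x ^ (-(1 / K ^ 2))) + 1 / 8 * K * y * (1 - y ^ (-(1 / K ^ 2))) +
        max x y := by
  have hK0 : 0 < K := by linarith
  have hε1 : 1 / K ^ 2 ≤ 1 := by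
    rw [div_le_one (by positivity)]
    nlinarith
  have hε : 0 ≤ 1 / K ^ 2 := by positivity
  have h1 := mul_rpow_neg_sub_le (N := x + y) (by linarith) (by linarith) (by linarith) hε hε1
    (x := x)
  have h2 := mul_rpow_neg_sub_le (N := x + y) (by linarith) (by linarith) (by linarith) hε hε1
    (x := y)
  have hKε : K * (1 / K ^ 2) ≤ 1 := by
    rw [show K * (1 / K ^ 2) = 1 / K by field_simp, div_le_one hK0]
    exact hK
  have h3 := mul_le_mul_of_nonneg_left (add_le_add h1 h2) hK0.le
  have h4 : K * (1 / K ^ 2) * (x + y) ≤ x + y := by nlinarith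
  have h5 := le_max_left x y
  have h6 := le_max_right x y
  linarith

theorem card_sumDilate_ge (K : ℝ) (hK : 1 ≤ K) (A : Finset ℝ) (hA : A.Nonempty) :
    1 / 8 * K * A.card * (1 - (A.card : ℝ) ^ (-(1 / K ^ 2))) ≤ (sumDilate K A).card := by
  induction A using Finset.strongInduction with
  | H A ih =>
    obtain ⟨m, hm, hmA⟩ := Finset.exists_min_image A id hA
    obtain ⟨M, hM, hMA⟩ := Finset.exists_max_image A id hA
    simp only [id] at hmA hMA
    rcases (hmA M hM).eq_or_lt with rfl | hmM
    · have : A = {m} := Finset.eq_singleton_iff_unique_mem.2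
        ⟨hm, fun a ha => le_antisymm (hMA a ha) (hmA a ha)⟩
      simp [this]
    by_cases hgap : ∀ a ∈ A, a < M → ∃ b ∈ A, a < b ∧ K * (b - a) < M - m
    · refine le_trans ?_ (half_mul_card_le_card_sumDilate hK hm hmA hM hMA hmM hgap)
      have hpow : 0 ≤ (A.card : ℝ) ^ (-(1 / K ^ 2)) := by positivity
      have hKA : 0 ≤ K * A.card := by positivity
      nlinarith
    · push Not at hgap
      obtain ⟨u, hu, huM, hgap⟩ := hgap
      have hne : (A.filter (u < ·)).Nonempty := ⟨M, Finset.mem_filter.2 ⟨hM, huM⟩⟩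
      obtain ⟨v, hv, hvmin⟩ := Finset.exists_min_image _ id hne
      obtain ⟨hvA, huv⟩ := Finset.mem_filter.1 hv
      have hcard := card_sumDilate_of_large_gap hK hmA hMA hu hvA huv
        (fun a ha hua => hvmin a (Finset.mem_filter.2 ⟨ha, hua⟩)) (hgap v hvA huv)
      have hsum := Finset.card_filter_add_card_filter_not (s := A) (· ≤ u)
      have hne1 : (A.filter (· ≤ u)).Nonempty := ⟨u, by simpa using hu⟩
      have hne2 : (A.filter (¬ · ≤ u)).Nonempty := ⟨M, by simpa using ⟨hM, huM⟩⟩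
      have ih1 := ih (A.filter (· ≤ u)) (Finset.filter_ssubset.2 ⟨M, hM, not_le.2 huM⟩) hne1
      have ih2 := ih (A.filter (¬ · ≤ u)) (Finset.filter_ssubset.2 ⟨u, hu, not_not.2 le_rfl⟩) hne2
      have hbound := lower_bound_add_le hK (Nat.one_le_cast.2 hne1.card_pos)
        (Nat.one_le_cast.2 hne2.card_pos)
      rw [← Nat.cast_add, hsum] at hbound
      have hcard' := (Nat.cast_le (α := ℝ)).2 hcard
      push_cast at hcard'
      linarith

/-- For a finite set `A ⊆ ℝ` of size `n ≥ 1` and a real `K ≥ 1`, the dilated sumset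
`A + K·A = {a + K·a' : a, a' ∈ A}` has at least `(1/8)·K·n·(1 − n^{−1/K²})` elements. -/
theorem sum_of_dilate_lower_bound
    (K : ℝ) (hK : 1 ≤ K) (A : Finset ℝ) (n : ℕ) (hn : A.card = n) (hn1 : 1 ≤ n) :
    ((((A ×ˢ A).image fun p => p.1 + K * p.2).card : ℝ)) ≥
      (1 / 8) * K * n * (1 - (n : ℝ) ^ (-(1 / K ^ 2))) := by
  subst hn
  exact card_sumDilate_ge K hK A (Finset.card_pos.1 hn1)
end

section
/- There exists an absolute constant C > 0 such that for every real number K ≥ 1 and every finite set A ⊆ ℝ one has |A + K·A| ≥ (1/10)·K·|A| − exp(C·K²), where A + K·A := {a + K·a' : a, a' ∈ A}. -/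
/-- The set `A + K·A` of all `a + K * a'` with `a, a' ∈ A`. -/
noncomputable def sumOfDilate (K : ℝ) (A : Finset ℝ) : Finset ℝ :=
  (A ×ˢ A).image fun p => p.1 + K * p.2

lemma add_mul_mem_sumOfDilate {K : ℝ} {A : Finset ℝ} {a b : ℝ} (ha : a ∈ A) (hb : b ∈ A) :
    a + K * b ∈ sumOfDilate K A :=
  Finset.mem_image.2 ⟨(a, b), Finset.mk_mem_product ha hb, rfl⟩

lemma mem_sumOfDilate {K : ℝ} {A : Finset ℝ} {x : ℝ} :
    x ∈ sumOfDilate K A ↔ ∃ a ∈ A, ∃ b ∈ A, a + K * b = x := by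
  simp [sumOfDilate, and_assoc]

/-- If translates of `A` by `K * b i` are pairwise disjoint because the points `b i` of `A` are
far apart compared with the diameter of `A`, then `A + K·A` contains all of them. -/
lemma mul_card_le_card_sumOfDilate {K L : ℝ} {A : Finset ℝ} {m : ℕ} (b : ℕ → ℝ)
    (hdiam : ∀ x ∈ A, ∀ y ∈ A, x - y ≤ L) (hb : ∀ i < m, b i ∈ A)
    (hsep : ∀ i j, i < j → j < m → L < K * b j - K * b i) :
    m * A.card ≤ (sumOfDilate K A).card := by
  have key : (Finset.range m ×ˢ A).card ≤ (sumOfDilate K A).card := by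
    refine Finset.card_le_card_of_injOn (fun p => p.2 + K * b p.1) ?_ ?_
    · rintro ⟨i, a⟩ h
      simp only [Finset.coe_product, Set.mem_prod, Finset.mem_coe, Finset.mem_range] at h
      exact add_mul_mem_sumOfDilate h.2 (hb i h.1)
    · rintro ⟨i, a⟩ h ⟨j, c⟩ h' heq
      simp only [Finset.coe_product, Set.mem_prod, Finset.mem_coe, Finset.mem_range] at h h' heq
      rcases lt_trichotomy i j with hij | rfl | hij
      · linarith [hsep i j hij h'.1, hdiam a h.2 c h'.2]
      · simpa using heq
      · linarith [hsep j i hij h.1, hdiam c h'.2 a h.2]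
  simpa using key

/-- If `A`, of diameter `L`, splits into parts `U < V` separated by a gap longer than `L / K`,
then `A + K·A` contains disjoint copies of `U + K·U`, `V + K·V`, `U` and `V`. -/
lemma card_sumOfDilate_union {K L : ℝ} (hK : 0 ≤ K) {A U V : Finset ℝ}
    (hdiam : ∀ x ∈ A, ∀ y ∈ A, x - y ≤ L) (hU : U ⊆ A) (hV : V ⊆ A)
    (hUn : U.Nonempty) (hVn : V.Nonempty) (hUV : ∀ u ∈ U, ∀ v ∈ V, u < v)
    (hgap : ∀ u ∈ U, ∀ v ∈ V, L < K * v - K * u) :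
    (sumOfDilate K U).card + (sumOfDilate K V).card + U.card + V.card
      ≤ (sumOfDilate K A).card := by
  set p := U.max' hUn
  set q := V.min' hVn
  have hpU : p ∈ U := U.max'_mem hUn
  have hqV : q ∈ V := V.min'_mem hVn
  have hpq : L < K * q - K * p := hgap p hpU q hqV
  have le_p : ∀ u ∈ U, u ≤ p := fun u hu => U.le_max' u hu
  have q_le : ∀ v ∈ V, q ≤ v := fun v hv => V.min'_le v hv
  set S := V.image fun v => v + K * p
  set T := U.image fun u => u + K * q
  have hScard : S.card = V.card := Finset.card_image_of_injective _ (add_left_injective _)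
  have hTcard : T.card = U.card := Finset.card_image_of_injective _ (add_left_injective _)
  have hU_le : ∀ x ∈ sumOfDilate K U, x ≤ p + K * p := by
    intro x hx
    obtain ⟨a, ha, b, hb, rfl⟩ := mem_sumOfDilate.1 hx
    exact add_le_add (le_p a ha) (mul_le_mul_of_nonneg_left (le_p b hb) hK)
  have le_hV : ∀ x ∈ sumOfDilate K V, q + K * q ≤ x := by
    intro x hx
    obtain ⟨a, ha, b, hb, rfl⟩ := mem_sumOfDilate.1 hx
    exact add_le_add (q_le a ha) (mul_le_mul_of_nonneg_left (q_le b hb) hK)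
  have d₁ : Disjoint (sumOfDilate K U) S := by
    refine Finset.disjoint_left.2 fun x hx hxS => ?_
    obtain ⟨v, hv, rfl⟩ := Finset.mem_image.1 hxS
    linarith [hU_le _ hx, hUV p hpU v hv]
  have d₂ : Disjoint (sumOfDilate K U ∪ S) T := by
    refine Finset.disjoint_left.2 fun x hx hxT => ?_
    obtain ⟨u, hu, rfl⟩ := Finset.mem_image.1 hxT
    rcases Finset.mem_union.1 hx with hx | hx
    · linarith [hU_le _ hx, hdiam p (hU hpU) u (hU hu)]
    · obtain ⟨v, hv, hvu⟩ := Finset.mem_image.1 hx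
      linarith [hdiam v (hV hv) u (hU hu)]
  have d₃ : Disjoint (sumOfDilate K U ∪ S ∪ T) (sumOfDilate K V) := by
    refine Finset.disjoint_left.2 fun x hx hxV => ?_
    have hqx := le_hV x hxV
    rcases Finset.mem_union.1 hx with hx | hx
    · rcases Finset.mem_union.1 hx with hx | hx
      · linarith [hU_le _ hx, hUV p hpU q hqV, hdiam p (hU hpU) p (hU hpU)]
      · obtain ⟨v, hv, rfl⟩ := Finset.mem_image.1 hx
        linarith [hdiam v (hV hv) q (hV hqV)]
    · obtain ⟨u, hu, rfl⟩ := Finset.mem_image.1 hx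
      linarith [hUV u hu q hqV]
  have hsub : sumOfDilate K U ∪ S ∪ T ∪ sumOfDilate K V ⊆ sumOfDilate K A := by
    intro x hx
    simp only [Finset.mem_union] at hx
    rcases hx with ((hx | hx) | hx) | hx
    · obtain ⟨a, ha, b, hb, rfl⟩ := mem_sumOfDilate.1 hx
      exact add_mul_mem_sumOfDilate (hU ha) (hU hb)
    · obtain ⟨v, hv, rfl⟩ := Finset.mem_image.1 hx
      exact add_mul_mem_sumOfDilate (hV hv) (hU hpU)
    · obtain ⟨u, hu, rfl⟩ := Finset.mem_image.1 hx
      exact add_mul_mem_sumOfDilate (hU hu) (hV hqV)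
    · obtain ⟨a, ha, b, hb, rfl⟩ := mem_sumOfDilate.1 hx
      exact add_mul_mem_sumOfDilate (hV ha) (hV hb)
  have hcard := Finset.card_le_card hsub
  rw [Finset.card_union_of_disjoint d₃, Finset.card_union_of_disjoint d₂,
    Finset.card_union_of_disjoint d₁] at hcard
  omega

/-- A finite set whose points leave no gap longer than `L / K`, where `L` is its diameter,
satisfies `|A + K·A| ≥ K |A| / 3`. -/
lemma card_sumOfDilate_of_no_gap {K p L : ℝ} (hK : 0 < K) (hL : 0 < L) {A : Finset ℝ}
    (hA : ∀ x ∈ A, p ≤ x ∧ x ≤ p + L)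
    (hgap : ∀ x, p ≤ x → x ≤ p + L → ∃ a ∈ A, x ≤ a ∧ a ≤ x + L / K) :
    K / 3 * A.card ≤ (sumOfDilate K A).card := by
  set m := ⌊K / 3⌋₊ + 1 with hm
  have hex : ∀ i : ℕ, ∃ a, i < m →
      a ∈ A ∧ p + 3 * i * (L / K) ≤ a ∧ a ≤ p + 3 * i * (L / K) + L / K := by
    intro i
    by_cases hi : i < m
    · have hiK : (i : ℝ) ≤ K / 3 :=
        (Nat.le_floor_iff (by positivity)).1 (Nat.lt_succ_iff.1 hi)
      have hle : 3 * i * (L / K) ≤ L := by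
        calc 3 * i * (L / K) ≤ K * (L / K) := by gcongr; linarith
          _ = L := by field_simp
      have hnn : 0 ≤ 3 * i * (L / K) := by positivity
      obtain ⟨a, ha, h⟩ := hgap (p + 3 * i * (L / K)) (by linarith) (by linarith)
      exact ⟨a, fun _ => ⟨ha, h⟩⟩
    · exact ⟨0, fun h => absurd h hi⟩
  choose b hb using hex
  have hcard : m * A.card ≤ (sumOfDilate K A).card := by
    refine mul_card_le_card_sumOfDilate (L := L) b
      (fun x hx y hy => by linarith [(hA x hx).2, (hA y hy).1]) (fun i hi => (hb i hi).1) ?_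
    intro i j hij hj
    have hij' : (i : ℝ) + 1 ≤ j := by exact_mod_cast hij
    have hLK : 0 < L / K := by positivity
    have h₁ := (hb i (hij.trans hj)).2.2
    have h₂ := (hb j hj).2.1
    have h₃ : 2 * (L / K) ≤ b j - b i := by nlinarith
    have h₄ : K * (2 * (L / K)) ≤ K * (b j - b i) := by gcongr
    have h₅ : K * (2 * (L / K)) = 2 * L := by field_simp
    linarith
  have hKm : K / 3 ≤ (m : ℝ) := by
    rw [hm]; push_cast; exact (Nat.lt_floor_add_one _).le
  calc K / 3 * A.card ≤ (m : ℝ) * A.card := by gcongr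
    _ ≤ _ := by exact_mod_cast hcard

/-- One summand of the superadditivity of `n ↦ n * min t (log n)` up to a linear term. -/
lemma mul_min_log_add_le {t a b : ℝ} (ha : 0 < a) (hb : 0 ≤ b) :
    a * min t (Real.log (a + b)) ≤ a * min t (Real.log a) + b := by
  rcases min_choice t (Real.log a) with h | h <;> rw [h]
  · have := mul_le_mul_of_nonneg_left (min_le_left t (Real.log (a + b))) ha.le
    linarith
  · have h₁ := mul_le_mul_of_nonneg_left (min_le_right t (Real.log (a + b))) ha.le
    have h₂ : Real.log (a + b) - Real.log a ≤ (a + b) / a - 1 := by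
      rw [← Real.log_div (by positivity) ha.ne']
      exact Real.log_le_sub_one_of_pos (by positivity)
    have h₃ := mul_le_mul_of_nonneg_left h₂ ha.le
    have h₄ : a * ((a + b) / a - 1) = b := by field_simp; ring
    linarith

/-- For `K > 0`, `|A + K·A| ≥ |A| * min (K / 3) (log |A|)`. -/
theorem card_mul_min_log_le_card_sumOfDilate {K : ℝ} (hK : 0 < K) (A : Finset ℝ) :
    A.card * min (K / 3) (Real.log A.card) ≤ (sumOfDilate K A).card := by
  induction A using Finset.strongInduction with
  | H A ih =>
    rcases Nat.lt_or_ge 1 A.card with h1 | h1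
    swap
    · have hlog : Real.log A.card ≤ 0 :=
        Real.log_nonpos (by positivity) (by exact_mod_cast h1)
      exact (mul_nonpos_of_nonneg_of_nonpos (by positivity)
        ((min_le_right _ _).trans hlog)).trans (by positivity)
    have hne : A.Nonempty := Finset.card_pos.1 (by omega)
    have hlt : A.min' hne < A.max' hne := Finset.min'_lt_max'_of_card A h1
    set p := A.min' hne
    set L := A.max' hne - p
    have hLpos : 0 < L := sub_pos.2 hlt
    have hA : ∀ x ∈ A, p ≤ x ∧ x ≤ p + L := fun x hx =>
      ⟨A.min'_le x hx, by linarith [A.le_max' x hx]⟩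
    by_cases hgap : ∀ x, p ≤ x → x ≤ p + L → ∃ a ∈ A, x ≤ a ∧ a ≤ x + L / K
    · have h := card_sumOfDilate_of_no_gap hK hLpos hA hgap
      have h' : (A.card : ℝ) * min (K / 3) (Real.log A.card) ≤ A.card * (K / 3) := by
        gcongr; exact min_le_left _ _
      linarith
    push Not at hgap
    obtain ⟨x, hpx, hxL, hx⟩ := hgap
    have hLK : 0 < L / K := by positivity
    have hpA : p ∈ A := A.min'_mem hne
    have hqA : A.max' hne ∈ A := A.max'_mem hne
    have hpx' : p < x := by
      by_contra hcon
      linarith [hx p hpA (not_lt.1 hcon)]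
    set U := A.filter (· < x)
    set V := A.filter (fun a => ¬ a < x)
    have hpU : p ∈ U := Finset.mem_filter.2 ⟨hpA, hpx'⟩
    have hqV : A.max' hne ∈ V := Finset.mem_filter.2 ⟨hqA, not_lt.2 (by linarith)⟩
    have hUA : U ⊆ A := Finset.filter_subset _ _
    have hVA : V ⊆ A := Finset.filter_subset _ _
    have hUss : U ⊂ A := Finset.ssubset_iff_subset_ne.2
      ⟨hUA, fun h => (Finset.mem_filter.1 hqV).2 (Finset.mem_filter.1 (h.symm.subset hqA)).2⟩
    have hVss : V ⊂ A := Finset.ssubset_iff_subset_ne.2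
      ⟨hVA, fun h => (Finset.mem_filter.1 (h.symm.subset hpA)).2 hpx'⟩
    have hUV : ∀ u ∈ U, ∀ v ∈ V, u + L / K < v := by
      intro u hu v hv
      have hv' := Finset.mem_filter.1 hv
      linarith [(Finset.mem_filter.1 hu).2, hx v hv'.1 (not_lt.1 hv'.2)]
    have hsplit := card_sumOfDilate_union (L := L) hK.le
      (fun a ha b hb => by linarith [(hA a ha).2, (hA b hb).1]) hUA hVA ⟨p, hpU⟩ ⟨_, hqV⟩
      (fun u hu v hv => by linarith [hUV u hu v hv])
      (fun u hu v hv => by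
        have h₁ := mul_lt_mul_of_pos_left (hUV u hu v hv) hK
        have h₂ : K * (u + L / K) = K * u + L := by field_simp
        linarith)
    have hcard : (A.card : ℝ) = U.card + V.card := by
      exact_mod_cast (Finset.card_filter_add_card_filter_not (s := A) (· < x)).symm
    have hUpos : (0 : ℝ) < U.card := by exact_mod_cast Finset.card_pos.2 ⟨p, hpU⟩
    have hVpos : (0 : ℝ) < V.card := by exact_mod_cast Finset.card_pos.2 ⟨_, hqV⟩
    have hsplit' : ((sumOfDilate K U).card : ℝ) + (sumOfDilate K V).card + U.card + V.card
      ≤ (sumOfDilate K A).card := by exact_mod_cast hsplit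
    have e₁ := mul_min_log_add_le (t := K / 3) hUpos hVpos.le
    have e₂ := mul_min_log_add_le (t := K / 3) hVpos hUpos.le
    rw [add_comm (V.card : ℝ)] at e₂
    have i₁ := ih U hUss
    have i₂ := ih V hVss
    rw [hcard, add_mul]
    linarith

/-- There is an absolute constant `C > 0` such that for all real `K ≥ 1` and all finite
`A ⊆ ℝ` one has `|A + K·A| ≥ (1/10)·K·|A| − exp(C·K²)`, where
`A + K·A = {a + K·a' : a, a' ∈ A}`. -/
theorem sum_of_dilate_lower_bound_exp :
    ∃ C : ℝ, 0 < C ∧ ∀ K : ℝ, 1 ≤ K → ∀ A : Finset ℝ,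
      ((((A ×ˢ A).image fun p => p.1 + K * p.2).card : ℝ)) ≥
        (1 / 10) * K * A.card - Real.exp (C * K ^ 2) := by
  refine ⟨1, one_pos, fun K hK A => ?_⟩
  have hK0 : 0 < K := by linarith
  have h := card_mul_min_log_le_card_sumOfDilate hK0 A
  change _ ≤ ((sumOfDilate K A).card : ℝ)
  have hn : (0 : ℝ) ≤ A.card := by positivity
  have hexp := Real.exp_pos (1 * K ^ 2)
  rcases le_or_gt (K / 3) (Real.log A.card) with hlog | hlog
  · rw [min_eq_left hlog] at h
    nlinarith
  · have hcard : (A.card : ℝ) ≤ Real.exp (K / 3) := by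
      rcases hn.eq_or_lt with h0 | h0
      · rw [← h0]; positivity
      · exact ((Real.log_lt_iff_lt_exp h0).1 hlog).le
    have hKe : K / 3 ≤ Real.exp (K / 3) := by linarith [Real.add_one_le_exp (K / 3)]
    have hprod : K / 3 * A.card ≤ Real.exp (1 * K ^ 2) := by
      calc K / 3 * A.card ≤ Real.exp (K / 3) * Real.exp (K / 3) := by gcongr
        _ = Real.exp (K / 3 + K / 3) := (Real.exp_add _ _).symm
        _ ≤ Real.exp (1 * K ^ 2) := Real.exp_le_exp.2 (by nlinarith)
    have hS : (0 : ℝ) ≤ (sumOfDilate K A).card := by positivity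
    nlinarith
end

section
/- For every real number K ≥ 1 and every natural number m there exists a finite set A ⊆ ℝ with |A| ≥ m, together with maps φ_a : A → ℝ for each a ∈ A satisfying: (i) each φ_a is injective; (ii) φ_a(a) = a; (iii) |a − φ_a(x)| ≤ (1/K)|a − x| for all x ∈ A; such that |⋃_{a ∈ A} φ_a(A)| = 2|A|. (In particular, conclusion of the main theorem fails badly without the betweenness condition (iv).) -/
open scoped symmDiff

/-- Changing an index set by `v` changes the sum of powers by at most the sum over `v`. -/
theorem abs_sum_pow_sub_sum_pow_symmDiff_le {R : ℝ} (hR : 0 ≤ R) (u v : Finset ℕ) :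
    |∑ i ∈ u, R ^ i - ∑ i ∈ u ∆ v, R ^ i| ≤ ∑ i ∈ v, R ^ i := by
  have h₁ := Finset.sum_inter_add_sum_sdiff u v (fun i => R ^ i)
  have h₂ := Finset.sum_inter_add_sum_sdiff v u (fun i => R ^ i)
  have h₃ : ∑ i ∈ u ∆ v, R ^ i = ∑ i ∈ u \ v, R ^ i + ∑ i ∈ v \ u, R ^ i :=
    Finset.sum_union disjoint_sdiff_sdiff
  have h₄ : 0 ≤ ∑ i ∈ u ∩ v, R ^ i := Finset.sum_nonneg fun i _ => pow_nonneg hR i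
  have h₅ : 0 ≤ ∑ i ∈ v \ u, R ^ i := Finset.sum_nonneg fun i _ => pow_nonneg hR i
  rw [Finset.inter_comm v u] at h₂
  rw [abs_le]
  constructor <;> linarith

theorem two_mul_sum_pow_le_pow {R : ℝ} (hR : 3 ≤ R) {t : Finset ℕ} {j : ℕ}
    (ht : ∀ i ∈ t, i < j) : 2 * ∑ i ∈ t, R ^ i ≤ R ^ j := by
  have hsub : ∑ i ∈ t, R ^ i ≤ ∑ i ∈ Finset.range j, R ^ i :=
    Finset.sum_le_sum_of_subset_of_nonneg (fun i hi => Finset.mem_range.2 (ht i hi))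
      fun i _ _ => by positivity
  have hgeom := geom_sum_mul R j
  have hpos : 0 ≤ ∑ i ∈ Finset.range j, R ^ i := Finset.sum_nonneg fun i _ => by positivity
  nlinarith

theorem two_mul_sum_pow_le_of_max_mem {R : ℝ} (hR : 3 ≤ R) {s t : Finset ℕ}
    (hst : Disjoint s t) {j : ℕ} (hj : j ∈ s) (hmax : ∀ i ∈ t, i ≤ j) :
    2 * ∑ i ∈ t, R ^ i ≤ ∑ i ∈ s, R ^ i :=
  (two_mul_sum_pow_le_pow hR fun i hi =>
    (hmax i hi).lt_of_ne fun h => Finset.disjoint_left.1 hst hj (h ▸ hi)).trans <|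
    Finset.single_le_sum (f := fun i => R ^ i) (fun i _ => by positivity) hj

theorem two_mul_sum_pow_le_or {R : ℝ} (hR : 3 ≤ R) {s t : Finset ℕ} (hst : Disjoint s t) :
    2 * ∑ i ∈ t, R ^ i ≤ ∑ i ∈ s, R ^ i ∨ 2 * ∑ i ∈ s, R ^ i ≤ ∑ i ∈ t, R ^ i := by
  rcases (s ∪ t).eq_empty_or_nonempty with h | h
  · obtain ⟨rfl, rfl⟩ := Finset.union_eq_empty.1 h
    simp
  · have hmax : ∀ i ∈ s ∪ t, i ≤ (s ∪ t).max' h := fun i hi => Finset.le_max' _ i hi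
    rcases Finset.mem_union.1 ((s ∪ t).max'_mem h) with hj | hj
    · exact .inl <| two_mul_sum_pow_le_of_max_mem hR hst hj fun i hi =>
        hmax i (Finset.mem_union_right _ hi)
    · exact .inr <| two_mul_sum_pow_le_of_max_mem hR hst.symm hj fun i hi =>
        hmax i (Finset.mem_union_left _ hi)

theorem sum_pow_symmDiff_le {R : ℝ} (hR : 3 ≤ R) (s t : Finset ℕ) :
    ∑ i ∈ s ∆ t, R ^ i ≤ 3 * |∑ i ∈ s, R ^ i - ∑ i ∈ t, R ^ i| := by
  have h₁ := Finset.sum_inter_add_sum_sdiff s t (fun i => R ^ i)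
  have h₂ := Finset.sum_inter_add_sum_sdiff t s (fun i => R ^ i)
  have h₃ : ∑ i ∈ s ∆ t, R ^ i = ∑ i ∈ s \ t, R ^ i + ∑ i ∈ t \ s, R ^ i :=
    Finset.sum_union disjoint_sdiff_sdiff
  rw [Finset.inter_comm t s] at h₂
  have hle := le_abs_self (∑ i ∈ s, R ^ i - ∑ i ∈ t, R ^ i)
  have hneg := neg_abs_le (∑ i ∈ s, R ^ i - ∑ i ∈ t, R ^ i)
  have hdisj : Disjoint (s \ t) (t \ s) := disjoint_sdiff_sdiff
  rcases two_mul_sum_pow_le_or hR hdisj with h | h <;> linarith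

theorem sum_pow_injective {R : ℝ} (hR : 3 ≤ R) :
    Function.Injective fun s : Finset ℕ => ∑ i ∈ s, R ^ i := by
  intro s t hst
  have hle := sum_pow_symmDiff_le hR s t
  rw [sub_eq_zero.2 hst, abs_zero, mul_zero] at hle
  by_contra hne
  have hpos : 0 < ∑ i ∈ s ∆ t, R ^ i :=
    Finset.sum_pos (fun i _ => by positivity)
      (Finset.nonempty_iff_ne_empty.2 fun h => hne (symmDiff_eq_bot.1 h))
  linarith

theorem sum_pow_image_succ (R : ℝ) (s : Finset ℕ) :
    ∑ i ∈ s.image (· + 1), R ^ i = R * ∑ i ∈ s, R ^ i := by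
  rw [Finset.sum_image (fun _ _ _ _ h => Nat.succ_injective h), Finset.mul_sum]
  exact Finset.sum_congr rfl fun i _ => pow_succ' R i

/-- Every index set in `{0, …, d}` is obtained from a shifted index set by changing it by a
difference of two index sets in `{0, …, d - 1}`. -/
theorem exists_image_succ_symmDiff_eq {d : ℕ} (hd : 0 < d) {u : Finset ℕ}
    (hu : u ⊆ Finset.range (d + 1)) :
    ∃ s ⊆ Finset.range d, ∃ t ⊆ Finset.range d, s.image (· + 1) ∆ (s ∆ t) = u := by
  refine ⟨(Finset.range d).filter (· + 1 ∈ u), Finset.filter_subset _ _,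
    (Finset.range d).filter (· + 1 ∈ u) ∆ (u ∩ {0}), ?_, ?_⟩
  · intro i hi
    simp only [Finset.mem_symmDiff, Finset.mem_filter, Finset.mem_inter, Finset.mem_singleton,
      Finset.mem_range] at hi ⊢
    grind
  · rw [symmDiff_symmDiff_cancel_left]
    ext i
    cases i with
    | zero => simp [Finset.mem_symmDiff]
    | succ i =>
      have := @hu (i + 1)
      simp only [Finset.mem_range] at this
      grind [Finset.mem_symmDiff]

theorem image_succ_symmDiff_subset {d : ℕ} {s t : Finset ℕ} (hs : s ⊆ Finset.range d)
    (ht : t ⊆ Finset.range d) : s.image (· + 1) ∆ (s ∆ t) ⊆ Finset.range (d + 1) := by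
  intro i hi
  simp only [Finset.mem_symmDiff, Finset.mem_image] at hi
  rw [Finset.mem_range]
  rcases hi with ⟨⟨k, hk, rfl⟩, -⟩ | ⟨⟨h, -⟩ | ⟨h, -⟩, -⟩
  · have := Finset.mem_range.1 (hs hk)
    omega
  · have := Finset.mem_range.1 (hs h)
    omega
  · have := Finset.mem_range.1 (ht h)
    omega

/-- Without the betweenness condition, the main theorem fails: for every `K ≥ 1` and
every `m` there is a finite set `A ⊆ ℝ` of size at least `m` and maps `φ a : A → ℝ`
(`a ∈ A`) that are injective, fix `a` and contract `A` towards `a` by a factor `K`,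
yet `|⋃_{a ∈ A} φ a '' A| = 2|A|`. -/
theorem counterexample_without_betweenness
    (K : ℝ) (hK : 1 ≤ K) (m : ℕ) :
    ∃ A : Finset ℝ, m ≤ A.card ∧
      ∃ φ : ℝ → ℝ → ℝ,
        (∀ a ∈ A, Set.InjOn (φ a) (A : Set ℝ)) ∧
        (∀ a ∈ A, φ a a = a) ∧
        (∀ a ∈ A, ∀ x ∈ A, |a - φ a x| ≤ (1 / K) * |a - x|) ∧
        (A.biUnion fun a => A.image (φ a)).card = 2 * A.card := by
  obtain ⟨R, hR3, hRK⟩ : ∃ R : ℝ, 3 ≤ R ∧ 3 * K = R := ⟨3 * K, by linarith, rfl⟩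
  let F : Finset ℕ → ℝ := fun s => ∑ i ∈ s, R ^ i
  let G : Finset ℕ → ℝ := fun s => F (s.image (· + 1))
  have hF : Function.Injective F := sum_pow_injective hR3
  have hG : Function.Injective G :=
    hF.comp (Finset.image_injective (add_left_injective 1))
  have hinv : ∀ s, Function.invFun G (G s) = s := Function.leftInverse_invFun hG
  let φ : ℝ → ℝ → ℝ := fun a x =>
    F ((Function.invFun G a).image (· + 1) ∆ (Function.invFun G a ∆ Function.invFun G x))
  have hφ : ∀ s t, φ (G s) (G t) = F (s.image (· + 1) ∆ (s ∆ t)) := fun s t => by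
    simp only [φ, hinv]
  have hcard : ((Finset.range (m + 1)).powerset.image G).card = 2 ^ (m + 1) := by
    rw [Finset.card_image_of_injective _ hG, Finset.card_powerset, Finset.card_range]
  refine ⟨(Finset.range (m + 1)).powerset.image G, ?_, φ, ?_, ?_, ?_, ?_⟩
  · rw [hcard]
    exact (Nat.le_succ m).trans Nat.lt_two_pow_self.le
  · intro a ha x hx y hy hxy
    obtain ⟨s, -, rfl⟩ := Finset.mem_image.1 ha
    obtain ⟨t, -, rfl⟩ := Finset.mem_image.1 hx
    obtain ⟨u, -, rfl⟩ := Finset.mem_image.1 hy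
    rw [hφ, hφ] at hxy
    rw [symmDiff_right_injective _ (symmDiff_right_injective _ (hF hxy))]
  · intro a ha
    obtain ⟨s, -, rfl⟩ := Finset.mem_image.1 ha
    rw [hφ, symmDiff_self, symmDiff_bot]
  · intro a ha x hx
    obtain ⟨s, -, rfl⟩ := Finset.mem_image.1 ha
    obtain ⟨t, -, rfl⟩ := Finset.mem_image.1 hx
    rw [hφ]
    refine (abs_sum_pow_sub_sum_pow_symmDiff_le (by linarith) _ _).trans
      ((sum_pow_symmDiff_le hR3 s t).trans_eq ?_)
    have hsub : G s - G t = 3 * K * (∑ i ∈ s, R ^ i - ∑ i ∈ t, R ^ i) := by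
      simp only [G, F, sum_pow_image_succ]
      rw [hRK, mul_sub]
    rw [hsub, abs_mul, abs_of_pos (by linarith : 0 < 3 * K)]
    field_simp
  · have hunion : (((Finset.range (m + 1)).powerset.image G).biUnion fun a =>
        ((Finset.range (m + 1)).powerset.image G).image (φ a)) =
        (Finset.range (m + 1 + 1)).powerset.image F := by
      ext y
      simp only [Finset.mem_biUnion, Finset.mem_image, Finset.mem_powerset]
      constructor
      · rintro ⟨_, ⟨s, hs, rfl⟩, _, ⟨t, ht, rfl⟩, rfl⟩
        exact ⟨_, image_succ_symmDiff_subset hs ht, (hφ s t).symm⟩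
      · rintro ⟨u, hu, rfl⟩
        obtain ⟨s, hs, t, ht, rfl⟩ := exists_image_succ_symmDiff_eq m.succ_pos hu
        exact ⟨_, ⟨s, hs, rfl⟩, _, ⟨t, ht, rfl⟩, hφ s t⟩
    rw [hunion, hcard, Finset.card_image_of_injective _ hF, Finset.card_powerset,
      Finset.card_range, pow_succ']
end

section
/- Let K > 2 be a real number and let A ⊆ ℝ be a finite set with |A| ≥ 2. Suppose for each a ∈ A we have a map φ_a : A → ℝ such that φ_a is injective and |a − φ_a(x)| ≤ (1/K)|a − x| for all x ∈ A. Let a₁ = min A and a₂ = max A. Then φ_{a₁}(A) and φ_{a₂}(A) are disjoint, and consequently |⋃_{a ∈ A} φ_a(A)| ≥ 2|A|. -/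
/-- If `K > 2`, `|A| ≥ 2` and each `φ a : A → ℝ` is injective with
`|a − φ a x| ≤ (1/K)|a − x|` on `A`, then the images of `A` under the maps attached to
the least and greatest elements of `A` are disjoint, so `|⋃_{a ∈ A} φ a '' A| ≥ 2|A|`. -/
theorem extreme_points_images_disjoint
    (K : ℝ) (hK : 2 < K) (A : Finset ℝ) (hA : 2 ≤ A.card)
    (hAne : A.Nonempty)
    (φ : ℝ → ℝ → ℝ)
    (hinj : ∀ a ∈ A, Set.InjOn (φ a) (A : Set ℝ))
    (hcontract : ∀ a ∈ A, ∀ x ∈ A, |a - φ a x| ≤ (1 / K) * |a - x|) :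
    Disjoint (A.image (φ (A.min' hAne))) (A.image (φ (A.max' hAne))) ∧
      2 * A.card ≤ (A.biUnion fun a => A.image (φ a)).card := by
  have hm := A.min'_mem hAne
  have hM := A.max'_mem hAne
  have hlt : A.min' hAne < A.max' hAne := A.min'_lt_max'_of_card (by omega)
  have hmle : ∀ x ∈ A, A.min' hAne ≤ x := fun x hx => A.min'_le x hx
  have hleM : ∀ x ∈ A, x ≤ A.max' hAne := fun x hx => A.le_max' x hx
  generalize A.min' hAne = m at *
  generalize A.max' hAne = M at *
  have hK0 : 0 ≤ 1 / K := by positivity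
  have hK2 : 1 / K < 1 / 2 := one_div_lt_one_div_of_lt two_pos hK
  have hdisj : Disjoint (A.image (φ m)) (A.image (φ M)) := by
    rw [Finset.disjoint_left]
    intro z hz hz'
    obtain ⟨x, hx, rfl⟩ := Finset.mem_image.1 hz
    obtain ⟨y, hy, hxy⟩ := Finset.mem_image.1 hz'
    have hx_le : |m - x| ≤ M - m := abs_le.2 ⟨by linarith [hleM x hx], by linarith [hmle x hx]⟩
    have hy_le : |M - y| ≤ M - m := abs_le.2 ⟨by linarith [hleM y hy], by linarith [hmle y hy]⟩
    have hφx := (hcontract m hm x hx).trans (mul_le_mul_of_nonneg_left hx_le hK0)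
    have hφy := (hcontract M hM y hy).trans (mul_le_mul_of_nonneg_left hy_le hK0)
    have hhalf : 1 / K * (M - m) < 1 / 2 * (M - m) :=
      mul_lt_mul_of_pos_right hK2 (sub_pos.2 hlt)
    linarith [(abs_le.1 hφx).1, (abs_le.1 hφy).2]
  refine ⟨hdisj, ?_⟩
  calc 2 * A.card = (A.image (φ m) ∪ A.image (φ M)).card := by
        rw [Finset.card_union_of_disjoint hdisj, Finset.card_image_of_injOn (hinj m hm),
          Finset.card_image_of_injOn (hinj M hM), two_mul]
    _ ≤ (A.biUnion fun a => A.image (φ a)).card :=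
        Finset.card_le_card <| Finset.union_subset
          (Finset.subset_biUnion_of_mem (fun a => A.image (φ a)) hm)
          (Finset.subset_biUnion_of_mem (fun a => A.image (φ a)) hM)
end

section
/- Let K ≥ 1 be a real number, let A ⊆ [0,1] be a finite set of size n with 0 ∈ A and 1 ∈ A, and suppose for each a ∈ A we have a map φ_a : A → ℝ satisfying: φ_a is injective, φ_a(a) = a, |a − φ_a(x)| ≤ (1/K)|a − x| for all x ∈ A, and min(a,x) ≤ φ_a(x) ≤ max(a,x) for all x ∈ A. Suppose there is a* ∈ A. Let A₁ := A ∩ [0, a* − 1/K) and A₂ := A ∩ (a* + 1/K, 1]. Then the three sets ⋃_{a ∈ A₁} φ_a(A₁), φ_{a*}(A), and ⋃_{a ∈ A₂} φ_a(A₂) are pairwise disjoint, and hence |⋃_{a ∈ A} φ_a(A)| ≥ |⋃_{a ∈ A₁} φ_a(A₁)| + n + |⋃_{a ∈ A₂} φ_a(A₂)|. -/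
/-- First case of the induction: with `A ⊆ [0,1]` containing `0` and `1`, `|A| = n`, maps
`φ a` injective, fixing `a`, `K`-contracting and satisfying betweenness, and any
`a* ∈ A`, setting `A₁ = A ∩ [0, a* − 1/K)` and `A₂ = A ∩ (a* + 1/K, 1]`, the sets
`⋃_{a ∈ A₁} φ a '' A₁`, `φ a* '' A` and `⋃_{a ∈ A₂} φ a '' A₂` are pairwise disjoint and
`|⋃_{a ∈ A} φ a '' A| ≥ |⋃_{a ∈ A₁} φ a '' A₁| + n + |⋃_{a ∈ A₂} φ a '' A₂|`. -/
theorem induction_first_case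
    (K : ℝ) (hK : 1 ≤ K) (A : Finset ℝ) (n : ℕ) (hn : A.card = n)
    (hA01 : ∀ x ∈ A, x ∈ Set.Icc (0 : ℝ) 1) (h0 : (0 : ℝ) ∈ A) (h1 : (1 : ℝ) ∈ A)
    (φ : ℝ → ℝ → ℝ)
    (hinj : ∀ a ∈ A, Set.InjOn (φ a) (A : Set ℝ))
    (hfix : ∀ a ∈ A, φ a a = a)
    (hcontract : ∀ a ∈ A, ∀ x ∈ A, |a - φ a x| ≤ (1 / K) * |a - x|)
    (hbetween : ∀ a ∈ A, ∀ x ∈ A, min a x ≤ φ a x ∧ φ a x ≤ max a x)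
    (astar : ℝ) (hastar : astar ∈ A)
    (A₁ A₂ : Finset ℝ)
    (hA₁ : A₁ = A.filter (fun x => 0 ≤ x ∧ x < astar - 1 / K))
    (hA₂ : A₂ = A.filter (fun x => astar + 1 / K < x ∧ x ≤ 1)) :
    Disjoint (A₁.biUnion fun a => A₁.image (φ a)) (A.image (φ astar)) ∧
    Disjoint (A₁.biUnion fun a => A₁.image (φ a)) (A₂.biUnion fun a => A₂.image (φ a)) ∧
    Disjoint (A.image (φ astar)) (A₂.biUnion fun a => A₂.image (φ a)) ∧
    (A₁.biUnion fun a => A₁.image (φ a)).card + n + (A₂.biUnion fun a => A₂.image (φ a)).card ≤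
      (A.biUnion fun a => A.image (φ a)).card := by
  have hA₁A : A₁ ⊆ A := hA₁ ▸ Finset.filter_subset _ _
  have hA₂A : A₂ ⊆ A := hA₂ ▸ Finset.filter_subset _ _
  have left_lt : ∀ y ∈ A₁.biUnion fun a => A₁.image (φ a), y < astar - 1 / K := by
    intro y hy
    simp only [Finset.mem_biUnion, Finset.mem_image] at hy
    obtain ⟨a, ha, x, hx, rfl⟩ := hy
    refine (hbetween a (hA₁A ha) x (hA₁A hx)).2.trans_lt (max_lt ?_ ?_)
    · exact (Finset.mem_filter.1 (hA₁ ▸ ha)).2.2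
    · exact (Finset.mem_filter.1 (hA₁ ▸ hx)).2.2
  have lt_right : ∀ y ∈ A₂.biUnion fun a => A₂.image (φ a), astar + 1 / K < y := by
    intro y hy
    simp only [Finset.mem_biUnion, Finset.mem_image] at hy
    obtain ⟨a, ha, x, hx, rfl⟩ := hy
    refine (lt_min ?_ ?_).trans_le (hbetween a (hA₂A ha) x (hA₂A hx)).1
    · exact (Finset.mem_filter.1 (hA₂ ▸ ha)).2.1
    · exact (Finset.mem_filter.1 (hA₂ ▸ hx)).2.1
  have inv_nonneg : 0 ≤ 1 / K := by positivity
  have middle_le : ∀ y ∈ A.image (φ astar), |astar - y| ≤ 1 / K := by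
    intro y hy
    obtain ⟨x, hx, rfl⟩ := Finset.mem_image.1 hy
    have hdist : |astar - x| ≤ 1 := by
      have hs := hA01 astar hastar
      have hx' := hA01 x hx
      exact abs_le.2 ⟨by linarith [hs.1, hx'.2], by linarith [hs.2, hx'.1]⟩
    exact (hcontract astar hastar x hx).trans (mul_le_of_le_one_right inv_nonneg hdist)
  have disj_left_middle :
      Disjoint (A₁.biUnion fun a => A₁.image (φ a)) (A.image (φ astar)) :=
    Finset.disjoint_left.2 fun y hy hy' => by
      linarith [left_lt y hy, (abs_le.1 (middle_le y hy')).2]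
  have disj_left_right :
      Disjoint (A₁.biUnion fun a => A₁.image (φ a)) (A₂.biUnion fun a => A₂.image (φ a)) :=
    Finset.disjoint_left.2 fun y hy hy' => by
      linarith [left_lt y hy, lt_right y hy']
  have disj_middle_right :
      Disjoint (A.image (φ astar)) (A₂.biUnion fun a => A₂.image (φ a)) :=
    Finset.disjoint_left.2 fun y hy hy' => by
      linarith [lt_right y hy', (abs_le.1 (middle_le y hy)).1]
  refine ⟨disj_left_middle, disj_left_right, disj_middle_right, ?_⟩
  have biUnion_subset : ∀ B ⊆ A,
      (B.biUnion fun a => B.image (φ a)) ⊆ A.biUnion fun a => A.image (φ a) := fun B hB =>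
    Finset.biUnion_subset.2 fun a ha => (Finset.image_subset_image hB).trans
      (Finset.subset_biUnion_of_mem (fun a => A.image (φ a)) (hB ha))
  rw [← hn, ← Finset.card_image_of_injOn (hinj astar hastar),
    ← Finset.card_union_of_disjoint disj_left_middle,
    ← Finset.card_union_of_disjoint
      (Finset.disjoint_union_left.2 ⟨disj_left_right, disj_middle_right⟩)]
  exact Finset.card_le_card (Finset.union_subset
    (Finset.union_subset (biUnion_subset A₁ hA₁A)
      (Finset.subset_biUnion_of_mem (fun a => A.image (φ a)) hastar))
    (biUnion_subset A₂ hA₂A))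
end

section
/- Let K ≥ 1 be a real number, let A ⊆ [0,1] be a finite set with 0 ∈ A and 1 ∈ A, and suppose for each a ∈ A we have a map φ_a : A → ℝ satisfying: φ_a is injective, φ_a(a) = a, |a − φ_a(x)| ≤ (1/K)|a − x| for all x ∈ A, and min(a,x) ≤ φ_a(x) ≤ max(a,x) for all x ∈ A. Suppose there is a* ∈ A with a* < 1 such that A ∩ (a*, a* + 1/K] = ∅. Let A₁ := A ∩ [0, a*] and A₂ := A ∩ (a* + 1/K, 1]. Then the three sets ⋃_{a ∈ A₁} φ_a(A₁), φ_{a*}(A₂), and ⋃_{a ∈ A₂} φ_a(A₂) are pairwise disjoint, and hence |⋃_{a ∈ A} φ_a(A)| ≥ |⋃_{a ∈ A₁} φ_a(A₁)| + |A₂| + |⋃_{a ∈ A₂} φ_a(A₂)|. -/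
/-- Second case of the induction: with `A ⊆ [0,1]` containing `0` and `1`, maps `φ a`
injective, fixing `a`, `K`-contracting and satisfying betweenness, and `a* ∈ A`, `a* < 1`,
such that `A ∩ (a*, a* + 1/K] = ∅`, setting `A₁ = A ∩ [0, a*]` and `A₂ = A ∩ (a* + 1/K, 1]`,
the sets `⋃_{a ∈ A₁} φ a '' A₁`, `φ a* '' A₂` and `⋃_{a ∈ A₂} φ a '' A₂` are pairwise
disjoint, and `|⋃_{a ∈ A} φ a '' A| ≥ |⋃_{a ∈ A₁} φ a '' A₁| + |A₂| + |⋃_{a ∈ A₂} φ a '' A₂|`. -/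
theorem induction_second_case
    (K : ℝ) (hK : 1 ≤ K) (A : Finset ℝ)
    (hA01 : ∀ x ∈ A, x ∈ Set.Icc (0 : ℝ) 1) (h0 : (0 : ℝ) ∈ A) (h1 : (1 : ℝ) ∈ A)
    (φ : ℝ → ℝ → ℝ)
    (hinj : ∀ a ∈ A, Set.InjOn (φ a) (A : Set ℝ))
    (hfix : ∀ a ∈ A, φ a a = a)
    (hcontract : ∀ a ∈ A, ∀ x ∈ A, |a - φ a x| ≤ (1 / K) * |a - x|)
    (hbetween : ∀ a ∈ A, ∀ x ∈ A, min a x ≤ φ a x ∧ φ a x ≤ max a x)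
    (astar : ℝ) (hastar : astar ∈ A) (hastar1 : astar < 1)
    (hgap : ∀ x ∈ A, x ∉ Set.Ioc astar (astar + 1 / K))
    (A₁ A₂ : Finset ℝ)
    (hA₁ : A₁ = A.filter (fun x => 0 ≤ x ∧ x ≤ astar))
    (hA₂ : A₂ = A.filter (fun x => astar + 1 / K < x ∧ x ≤ 1)) :
    Disjoint (A₁.biUnion fun a => A₁.image (φ a)) (A₂.image (φ astar)) ∧
    Disjoint (A₁.biUnion fun a => A₁.image (φ a)) (A₂.biUnion fun a => A₂.image (φ a)) ∧
    Disjoint (A₂.image (φ astar)) (A₂.biUnion fun a => A₂.image (φ a)) ∧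
    (A₁.biUnion fun a => A₁.image (φ a)).card + A₂.card +
        (A₂.biUnion fun a => A₂.image (φ a)).card ≤
      (A.biUnion fun a => A.image (φ a)).card := by
  have hK0 : 0 < 1 / K := by positivity
  have m₁ : ∀ x ∈ A₁, x ∈ A ∧ x ≤ astar := fun x hx => by
    rw [hA₁, Finset.mem_filter] at hx
    exact ⟨hx.1, hx.2.2⟩
  have m₂ : ∀ x ∈ A₂, x ∈ A ∧ astar + 1 / K < x := fun x hx => by
    rw [hA₂, Finset.mem_filter] at hx
    exact ⟨hx.1, hx.2.1⟩
  have low : ∀ y ∈ A₁.biUnion fun a => A₁.image (φ a), y ≤ astar := by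
    intro y hy
    simp only [Finset.mem_biUnion, Finset.mem_image] at hy
    obtain ⟨a, ha, x, hx, rfl⟩ := hy
    exact (hbetween a (m₁ a ha).1 x (m₁ x hx).1).2.trans (max_le (m₁ a ha).2 (m₁ x hx).2)
  have high : ∀ y ∈ A₂.biUnion fun a => A₂.image (φ a), astar + 1 / K < y := by
    intro y hy
    simp only [Finset.mem_biUnion, Finset.mem_image] at hy
    obtain ⟨a, ha, x, hx, rfl⟩ := hy
    exact (lt_min (m₂ a ha).2 (m₂ x hx).2).trans_le (hbetween a (m₂ a ha).1 x (m₂ x hx).1).1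
  have mid : ∀ y ∈ A₂.image (φ astar), astar < y ∧ y ≤ astar + 1 / K := by
    intro y hy
    obtain ⟨x, hx, rfl⟩ := Finset.mem_image.1 hy
    obtain ⟨hxA, hlt⟩ := m₂ x hx
    have hax : astar < x := by linarith
    constructor
    · have hle := (hbetween astar hastar x hxA).1
      rw [min_eq_left hax.le] at hle
      refine hle.lt_of_ne fun h => hax.ne ?_
      exact hinj astar hastar hastar hxA ((hfix astar hastar).trans h)
    · have hc := hcontract astar hastar x hxA
      have hdist : |astar - x| ≤ 1 := by
        rw [abs_le]
        constructor <;> linarith [(hA01 x hxA).2, (hA01 astar hastar).1]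
      have hmul := mul_le_of_le_one_right hK0.le hdist
      linarith [neg_le_abs (astar - φ astar x)]
  have d₁ : Disjoint (A₁.biUnion fun a => A₁.image (φ a)) (A₂.image (φ astar)) :=
    Finset.disjoint_left.2 fun y hy hy' => (low y hy).not_gt (mid y hy').1
  have d₂ : Disjoint (A₁.biUnion fun a => A₁.image (φ a))
      (A₂.biUnion fun a => A₂.image (φ a)) :=
    Finset.disjoint_left.2 fun y hy hy' => by linarith [low y hy, high y hy']
  have d₃ : Disjoint (A₂.image (φ astar)) (A₂.biUnion fun a => A₂.image (φ a)) :=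
    Finset.disjoint_left.2 fun y hy hy' => (mid y hy).2.not_gt (high y hy')
  refine ⟨d₁, d₂, d₃, ?_⟩
  have s₁ : A₁ ⊆ A := fun x hx => (m₁ x hx).1
  have s₂ : A₂ ⊆ A := fun x hx => (m₂ x hx).1
  have hcard : (A₂.image (φ astar)).card = A₂.card :=
    Finset.card_image_of_injOn ((hinj astar hastar).mono (Finset.coe_subset.2 s₂))
  rw [← hcard, ← Finset.card_union_of_disjoint d₁,
    ← Finset.card_union_of_disjoint (Finset.disjoint_union_left.2 ⟨d₂, d₃⟩)]
  have hsub : ∀ B ⊆ A, (B.biUnion fun a => B.image (φ a)) ⊆ A.biUnion fun a => A.image (φ a) :=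
    fun B hB => Finset.biUnion_subset.2 fun a ha => (Finset.image_subset_image hB).trans
      (Finset.subset_biUnion_of_mem (fun a => A.image (φ a)) (hB ha))
  exact Finset.card_le_card (Finset.union_subset (Finset.union_subset (hsub A₁ s₁)
    ((Finset.image_subset_image s₂).trans
      (Finset.subset_biUnion_of_mem (fun a => A.image (φ a)) hastar))) (hsub A₂ s₂))
end

section
/- Let K ≥ 1 be a real number and let A ⊆ [0,1] be a finite set of size n with 0 ∈ A and 1 ∈ A. Suppose that for every a ∈ A one has |A ∩ [a − 1/K, a + 1/K]| > 6n/K. Then there exists a* ∈ A with a* < 1 such that A ∩ (a*, a* + 1/K] = ∅. -/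
/-- If every point of `A` in `[0,1)` is followed by another one at distance at most `r`, then
every `x ∈ [0,1)` has a point of `A` in `(x - r, x]`. -/
lemma exists_mem_Ioc_of_forall_exists_next {A : Finset ℝ} {r : ℝ} (h0 : (0 : ℝ) ∈ A)
    (hnext : ∀ a ∈ A, a < 1 → ∃ y ∈ A, y ∈ Set.Ioc a (a + r)) {x : ℝ} (hx0 : 0 ≤ x)
    (hx1 : x < 1) : ∃ a ∈ A, x - r < a ∧ a ≤ x := by
  obtain ⟨a, ha, hmax⟩ := (A.filter (· ≤ x)).exists_max_image id
    ⟨0, Finset.mem_filter.2 ⟨h0, hx0⟩⟩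
  obtain ⟨haA, hax⟩ := Finset.mem_filter.1 ha
  obtain ⟨y, hyA, hay, hyr⟩ := hnext a haA (hax.trans_lt hx1)
  have hxy : x < y := by
    by_contra! hyx
    exact (hmax y (Finset.mem_filter.2 ⟨hyA, hyx⟩)).not_gt hay
  exact ⟨a, haA, by linarith, hax⟩


/-- Covering argument: if `A ⊆ [0,1]` is finite of size `n` with `0, 1 ∈ A` and every
`a ∈ A` has more than `6n/K` points of `A` within distance `1/K`, then there is an
`a* ∈ A` with `a* < 1` such that `A ∩ (a*, a* + 1/K] = ∅`. -/
theorem exists_gap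
    (K : ℝ) (hK : 1 ≤ K) (A : Finset ℝ) (n : ℕ) (hn : A.card = n)
    (hA01 : ∀ x ∈ A, x ∈ Set.Icc (0 : ℝ) 1) (h0 : (0 : ℝ) ∈ A) (h1 : (1 : ℝ) ∈ A)
    (hdense : ∀ a ∈ A,
      (6 : ℝ) * n / K < ((A.filter fun x => a - 1 / K ≤ x ∧ x ≤ a + 1 / K).card : ℝ)) :
    ∃ astar ∈ A, astar < 1 ∧ ∀ x ∈ A, x ∉ Set.Ioc astar (astar + 1 / K) := by
  by_contra! hnext
  have hK0 : 0 < K := by linarith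
  have hr : 0 < 1 / K := by positivity
  have hn0 : (0 : ℝ) < n := by
    rw [← hn]
    exact_mod_cast Finset.card_pos.2 ⟨0, h0⟩
  have hnear : ∀ j ∈ Finset.range ⌈K / 5⌉₊,
      ∃ a ∈ A, 5 * j * (1 / K) - 1 / K < a ∧ a ≤ 5 * j * (1 / K) := by
    intro j hj
    refine exists_mem_Ioc_of_forall_exists_next h0 hnext (by positivity) ?_
    have hj' : (j : ℝ) < K / 5 := Nat.lt_ceil.1 (Finset.mem_range.1 hj)
    rw [mul_one_div, div_lt_one hK0]
    linarith
  choose! f hfA hf_lower hf_upper using hnear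
  let B : ℕ → Finset ℝ := fun j => A.filter fun x => f j - 1 / K ≤ x ∧ x ≤ f j + 1 / K
  have hlt : ∀ i ∈ Finset.range ⌈K / 5⌉₊, ∀ j ∈ Finset.range ⌈K / 5⌉₊, i < j →
      Disjoint (B i) (B j) := by
    intro i hi j hj hij
    refine Finset.disjoint_left.2 fun x hxi hxj => ?_
    have hxi' := (Finset.mem_filter.1 hxi).2.2
    have hxj' := (Finset.mem_filter.1 hxj).2.1
    have hij' : (i : ℝ) + 1 ≤ j := by exact_mod_cast hij
    nlinarith [hf_upper i hi, hf_lower j hj, mul_le_mul_of_nonneg_right hij' hr.le]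
  have hdisj : (Finset.range ⌈K / 5⌉₊ : Set ℕ).PairwiseDisjoint B := by
    intro i hi j hj hij
    rcases lt_or_gt_of_ne hij with h | h
    · exact hlt i hi j hj h
    · exact (hlt j hj i hi h).symm
  have hcard : ∑ j ∈ Finset.range ⌈K / 5⌉₊, (B j).card ≤ n := by
    rw [← Finset.card_biUnion hdisj, ← hn]
    exact Finset.card_le_card (Finset.biUnion_subset.2 fun j _ => Finset.filter_subset _ _)
  have hsum : (⌈K / 5⌉₊ : ℝ) * (6 * n / K) ≤ n := by
    calc (⌈K / 5⌉₊ : ℝ) * (6 * n / K)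
        = ∑ j ∈ Finset.range ⌈K / 5⌉₊, 6 * (n : ℝ) / K := by simp
      _ ≤ ∑ j ∈ Finset.range ⌈K / 5⌉₊, ((B j).card : ℝ) :=
          Finset.sum_le_sum fun j hj => (hdense (f j) (hfA j hj)).le
      _ ≤ n := by exact_mod_cast hcard
  have hceil : K / 5 * (6 * n / K) ≤ ⌈K / 5⌉₊ * (6 * n / K) :=
    mul_le_mul_of_nonneg_right (Nat.le_ceil _) (by positivity)
  have hsix : K / 5 * (6 * n / K) = 6 / 5 * n := by field_simp
  linarith
end

section
/- Let K > 10⁴ be a real number and n ≥ 1. Define A := { Σ_{i=1}^{n} ε_i (4K)^{−i} : ε_i ∈ {0,1} } and à := { Σ_{i=1}^{n+1} ε_i (4K)^{−i} : ε_i ∈ {0,1} }. Then for every x ∈ A there exists a bijection ψ_x : à → à such that ψ_x(A) = A, ψ_x(0) = x, and (1/2)|t − t′| ≤ |ψ_x(t) − ψ_x(t′)| ≤ 2|t − t′| for all t, t′ ∈ Ã. -/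
theorem sum_mul_pow_succ_eq (r : ℝ) {N : ℕ} (a : Fin (N + 1) → ℝ) :
    ∑ i, a i * r ^ ((i : ℕ) + 1) =
      r * (a 0 + ∑ i : Fin N, a i.succ * r ^ ((i : ℕ) + 1)) := by
  rw [Fin.sum_univ_succ, mul_add, Finset.mul_sum]
  congr 1
  · simp [mul_comm]
  · refine Finset.sum_congr rfl fun i _ => ?_
    rw [Fin.val_succ]
    ring

/-- Expansions `∑ a i r^(i+1)` with digits in `{-1, 0, 1}` are bounded by `1/3` when `r ≤ 1/4`. -/
theorem abs_sum_signed_digits_le {r : ℝ} (hr : 0 ≤ r) (hr' : r ≤ 1 / 4) :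
    ∀ {N : ℕ} (a : Fin N → ℝ), (∀ i, a i = 0 ∨ |a i| = 1) →
      |∑ i, a i * r ^ ((i : ℕ) + 1)| ≤ 1 / 3
  | 0, a, _ => by norm_num
  | N + 1, a, ha => by
    have ih := abs_sum_signed_digits_le hr hr' (fun i : Fin N => a i.succ) fun i => ha i.succ
    have h0 : |a 0| ≤ 1 := by rcases ha 0 with h | h <;> simp [h]
    rw [sum_mul_pow_succ_eq, abs_mul, abs_of_nonneg hr]
    have := abs_add_le (a 0) (∑ i : Fin N, a i.succ * r ^ ((i : ℕ) + 1))
    nlinarith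

/-- Changing the signs of the digits in an expansion `∑ a i r^(i+1)` with digits in `{-1, 0, 1}`
changes its absolute value by a factor of at most `2` when `r ≤ 1/4`. -/
theorem abs_sum_signed_digits_le_two_mul {r : ℝ} (hr : 0 ≤ r) (hr' : r ≤ 1 / 4) :
    ∀ {N : ℕ} (a b : Fin N → ℝ), (∀ i, a i = 0 ∨ |a i| = 1) → (∀ i, |b i| = |a i|) →
      |∑ i, a i * r ^ ((i : ℕ) + 1)| ≤ 2 * |∑ i, b i * r ^ ((i : ℕ) + 1)|
  | 0, a, b, _, _ => by norm_num
  | N + 1, a, b, ha, hab => by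
    have hb : ∀ i, b i = 0 ∨ |b i| = 1 := fun i => by
      rw [hab, ← abs_eq_zero, hab, abs_eq_zero]
      exact ha i
    have ih := abs_sum_signed_digits_le_two_mul hr hr' (fun i : Fin N => a i.succ)
      (fun i => b i.succ) (fun i => ha i.succ) fun i => hab i.succ
    have ta := abs_sum_signed_digits_le hr hr' (fun i : Fin N => a i.succ) fun i => ha i.succ
    have tb := abs_sum_signed_digits_le hr hr' (fun i : Fin N => b i.succ) fun i => hb i.succ
    rw [sum_mul_pow_succ_eq r a, sum_mul_pow_succ_eq r b, abs_mul, abs_mul, abs_of_nonneg hr, mul_left_comm]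
    refine mul_le_mul_of_nonneg_left ?_ hr
    have h0 := hab 0
    rcases ha 0 with h | h
    · rw [h, abs_zero, abs_eq_zero] at h0
      rw [h, h0, zero_add, zero_add]
      exact ih
    · rw [h] at h0
      have h1 := abs_add_le (a 0) (∑ i : Fin N, a i.succ * r ^ ((i : ℕ) + 1))
      have h2 := abs_sub_abs_le_abs_add (b 0) (∑ i : Fin N, b i.succ * r ^ ((i : ℕ) + 1))
      linarith

/-- The binary digit sum `∑ ε i b^(-i-1)` in base `b`. -/
noncomputable def binaryDigitSum (b : ℝ) {N : ℕ} (ε : Fin N → Bool) : ℝ :=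
  ∑ i : Fin N, (if ε i then b ^ (-(i : ℤ) - 1) else 0)

theorem binaryDigitSum_sub {b : ℝ} {N : ℕ} (ε ε' : Fin N → Bool) :
    binaryDigitSum b ε - binaryDigitSum b ε' =
      ∑ i, ((if ε i then 1 else 0) - (if ε' i then 1 else 0)) * b⁻¹ ^ ((i : ℕ) + 1) := by
  have h : ∀ i : ℕ, b ^ (-(i : ℤ) - 1) = b⁻¹ ^ (i + 1) := fun i => by
    rw [← neg_add', zpow_neg, inv_pow]
    norm_cast
  simp only [binaryDigitSum, h, ← Finset.sum_sub_distrib]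
  refine Finset.sum_congr rfl fun i _ => ?_
  split_ifs <;> simp

theorem abs_binaryDigitSum_sub_le {b : ℝ} (hb : 4 ≤ b) {N : ℕ} {ε ε' η η' : Fin N → Bool}
    (h : ∀ i, ε i = ε' i ↔ η i = η' i) :
    |binaryDigitSum b ε - binaryDigitSum b ε'| ≤
      2 * |binaryDigitSum b η - binaryDigitSum b η'| := by
  rw [binaryDigitSum_sub, binaryDigitSum_sub]
  have hr : b⁻¹ ≤ 1 / 4 := by
    rw [one_div]
    exact inv_anti₀ (by norm_num) hb
  refine abs_sum_signed_digits_le_two_mul (by positivity) hr _ _ (fun i => ?_) fun i => ?_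
  · cases ε i <;> cases ε' i <;> simp
  · have := h i
    revert this
    cases ε i <;> cases ε' i <;> cases η i <;> cases η' i <;> simp

theorem binaryDigitSum_snoc_false (b : ℝ) {N : ℕ} (ε : Fin N → Bool) :
    binaryDigitSum b (Fin.snoc (α := fun _ => Bool) ε false) = binaryDigitSum b ε := by
  simp [binaryDigitSum, Fin.sum_univ_castSucc]


/-- For `K > 10⁴`, with `A` the set of sums `Σ_{i=1}^n ε_i (4K)^{−i}` and `Ã` the set of
sums `Σ_{i=1}^{n+1} ε_i (4K)^{−i}` over binary digit strings, every `x ∈ A` admits a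
bijection `ψ : Ã → Ã` with `ψ(A) = A`, `ψ(0) = x`, which is `2`-biLipschitz:
`(1/2)|t − t'| ≤ |ψ(t) − ψ(t')| ≤ 2|t − t'|` for all `t, t' ∈ Ã`. -/
theorem tree_automorphism_exists
    (K : ℝ) (hK : (10 : ℝ) ^ 4 < K) (n : ℕ) (hn : 1 ≤ n)
    (A Atil : Set ℝ)
    (hA : A = {t : ℝ | ∃ ε : Fin n → Bool,
      t = ∑ i : Fin n, (if ε i then (4 * K) ^ (-(i : ℤ) - 1) else 0)})
    (hAtil : Atil = {t : ℝ | ∃ ε : Fin (n + 1) → Bool,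
      t = ∑ i : Fin (n + 1), (if ε i then (4 * K) ^ (-(i : ℤ) - 1) else 0)}) :
    ∀ x ∈ A, ∃ ψ : ℝ → ℝ, Set.BijOn ψ Atil Atil ∧ ψ '' A = A ∧ ψ 0 = x ∧
      ∀ t ∈ Atil, ∀ t' ∈ Atil,
        (1 / 2) * |t - t'| ≤ |ψ t - ψ t'| ∧ |ψ t - ψ t'| ≤ 2 * |t - t'| := by
  have hb : (4 : ℝ) ≤ 4 * K := by linarith
  have hA' : ∀ t, t ∈ A ↔ ∃ ε : Fin n → Bool,
      binaryDigitSum (4 * K) (Fin.snoc (α := fun _ => Bool) ε false) = t := fun t => by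
    simp only [hA, binaryDigitSum_snoc_false, eq_comm (b := t)]
    rfl
  have hAtil' : ∀ t, t ∈ Atil ↔ ∃ ε : Fin (n + 1) → Bool, binaryDigitSum (4 * K) ε = t :=
    fun t => by
      simp only [hAtil, eq_comm (b := t)]
      rfl
  intro x hx
  obtain ⟨δ, rfl⟩ := (hA' x).1 hx
  set V : (Fin (n + 1) → Bool) → ℝ := binaryDigitSum (4 * K)
  set δ' : Fin (n + 1) → Bool := Fin.snoc (α := fun _ => Bool) δ false with hδ'
  let flip : (Fin (n + 1) → Bool) → Fin (n + 1) → Bool := fun ε i => xor (ε i) (δ' i)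
  have hflip : ∀ ε, flip (flip ε) = ε := fun ε => by
    funext i
    simp [flip]
  have hsnoc : ∀ ε : Fin n → Bool, flip (Fin.snoc (α := fun _ => Bool) ε false) =
      Fin.snoc (α := fun _ => Bool) (fun i => xor (ε i) (δ i)) false := fun ε => by
    funext i
    refine Fin.lastCases ?_ (fun j => ?_) i <;> simp [flip, hδ']
  have upper : ∀ ε ε', |V (flip ε) - V (flip ε')| ≤ 2 * |V ε - V ε'| := fun ε ε' =>
    abs_binaryDigitSum_sub_le hb fun i => by simp [flip]
  have lower : ∀ ε ε', |V ε - V ε'| ≤ 2 * |V (flip ε) - V (flip ε')| := fun ε ε' =>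
    abs_binaryDigitSum_sub_le hb fun i => by simp [flip]
  have hfac : Function.FactorsThrough (fun ε => V (flip ε)) V := fun ε ε' h => by
    have := upper ε ε'
    rw [h, sub_self, abs_zero, mul_zero] at this
    exact sub_eq_zero.1 (abs_nonpos_iff.1 this)
  let ψ : ℝ → ℝ := Function.extend V (fun ε => V (flip ε)) id
  have hψ : ∀ ε, ψ (V ε) = V (flip ε) := fun ε => hfac.extend_apply id ε
  refine ⟨ψ, ⟨?_, ?_, ?_⟩, ?_, ?_, ?_⟩
  · intro t ht
    obtain ⟨ε, rfl⟩ := (hAtil' t).1 ht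
    exact (hAtil' _).2 ⟨flip ε, (hψ ε).symm⟩
  · intro t ht t' ht' h
    obtain ⟨ε, rfl⟩ := (hAtil' t).1 ht
    obtain ⟨ε', rfl⟩ := (hAtil' t').1 ht'
    have := lower ε ε'
    rw [← hψ, ← hψ, h, sub_self, abs_zero, mul_zero] at this
    exact sub_eq_zero.1 (abs_nonpos_iff.1 this)
  · intro t ht
    obtain ⟨ε, rfl⟩ := (hAtil' t).1 ht
    exact ⟨V (flip ε), (hAtil' _).2 ⟨_, rfl⟩, by rw [hψ, hflip]⟩
  · ext t
    constructor
    · rintro ⟨s, hs, rfl⟩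
      obtain ⟨ε, rfl⟩ := (hA' s).1 hs
      exact (hA' _).2 ⟨_, by rw [hψ, hsnoc]⟩
    · intro ht
      obtain ⟨ε, rfl⟩ := (hA' t).1 ht
      refine ⟨V (flip (Fin.snoc (α := fun _ => Bool) ε false)), (hA' _).2 ⟨_, by rw [hsnoc]⟩, ?_⟩
      rw [hψ, hflip]
  · have h0 : V (fun _ => false) = 0 := by simp [V, binaryDigitSum]
    rw [← h0, hψ]
    congr 1
    funext i
    simp [flip]
  · intro t ht t' ht'
    obtain ⟨ε, rfl⟩ := (hAtil' t).1 ht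
    obtain ⟨ε', rfl⟩ := (hAtil' t').1 ht'
    rw [hψ, hψ]
    exact ⟨by linarith [lower ε ε'], upper ε ε'⟩
end

section
/- Let K, N, d be integers with d ≥ 1, N ≥ 1 and K ≥ N, and define A := { n₀ + n₁ K + ⋯ + n_{d−1} K^{d−1} : n₀, …, n_{d−1} ∈ {0, 1, …, N−1} } ⊆ ℝ. Then |A| = N^d and |A + K·A| ≤ 2^d · N^{d+1}, where A + K·A := {a + K·a' : a, a' ∈ A}. -/
/-- Base-`K` expansions with digits below `N ≤ K` are unique. -/
lemma sum_digit_mul_pow_injective {K N : ℕ} (hK : N ≤ K) (d : ℕ) :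
    Function.Injective fun f : Fin d → Fin N => ∑ i : Fin d, (f i : ℕ) * K ^ (i : ℕ) := by
  induction d with
  | zero => exact Function.injective_of_subsingleton _
  | succ d ih =>
    intro f g h
    have expand (f : Fin (d + 1) → Fin N) : ∑ i, (f i : ℕ) * K ^ (i : ℕ)
        = f 0 + K * ∑ i : Fin d, (f i.succ : ℕ) * K ^ (i : ℕ) := by
      rw [Fin.sum_univ_succ, Finset.mul_sum]
      simp only [Fin.val_zero, pow_zero, mul_one, Fin.val_succ, pow_succ]
      congr 1
      exact Finset.sum_congr rfl fun i _ => by ring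
    simp only [expand] at h
    have hf : (f 0 : ℕ) < K := (f 0).isLt.trans_le hK
    have hg : (g 0 : ℕ) < K := (g 0).isLt.trans_le hK
    have h0 : (f 0 : ℕ) = g 0 := by
      simpa [Nat.add_mul_mod_self_left, Nat.mod_eq_of_lt hf, Nat.mod_eq_of_lt hg]
        using congrArg (· % K) h
    rw [h0] at h
    have htail : (fun i : Fin d => f i.succ) = fun i => g i.succ :=
      ih (Nat.eq_of_mul_eq_mul_left (by omega) (Nat.add_left_cancel h))
    funext i
    refine Fin.cases (Fin.ext h0) (fun j => congrFun htail j) i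


/-- For integers `d ≥ 1`, `N ≥ 1`, `K ≥ N`, the set
`A = {n₀ + n₁K + ⋯ + n_{d−1}K^{d−1} : nᵢ ∈ {0, …, N−1}} ⊆ ℝ` satisfies `|A| = N^d` and
`|A + K·A| ≤ 2^d · N^(d+1)`, where `A + K·A = {a + K·a' : a, a' ∈ A}`. -/
theorem base_K_digit_set_small_dilate
    (K N d : ℕ) (hd : 1 ≤ d) (hN : 1 ≤ N) (hK : N ≤ K)
    (A : Finset ℝ)
    (hA : A = Finset.image
      (fun f : Fin d → Fin N => ∑ i : Fin d, ((f i : ℕ) : ℝ) * (K : ℝ) ^ (i : ℕ))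
      Finset.univ) :
    A.card = N ^ d ∧
      ((A ×ˢ A).image fun p => p.1 + (K : ℝ) * p.2).card ≤ 2 ^ d * N ^ (d + 1) := by
  subst hA
  refine ⟨?_, ?_⟩
  · rw [Finset.card_image_of_injective]
    · simp
    · intro f g h
      exact sum_digit_mul_pow_injective hK d (by dsimp only at h ⊢; exact_mod_cast h)
  obtain ⟨e, rfl⟩ := Nat.exists_eq_add_of_le' hd
  let F : Fin N × (Fin e → Fin (2 * N)) × Fin N → ℝ := fun p =>
    ((p.1 : ℕ) : ℝ) + ∑ i : Fin e, ((p.2.1 i : ℕ) : ℝ) * (K : ℝ) ^ ((i : ℕ) + 1)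
      + ((p.2.2 : ℕ) : ℝ) * (K : ℝ) ^ (e + 1)
  calc _ ≤ (Finset.univ.image F).card := by
        refine Finset.card_le_card fun x hx => ?_
        simp only [Finset.mem_image, Finset.mem_product, Finset.mem_univ, true_and,
          Prod.exists] at hx
        obtain ⟨_, _, ⟨⟨f, rfl⟩, ⟨g, rfl⟩⟩, rfl⟩ := hx
        refine Finset.mem_image.2 ⟨(f 0, fun i => ⟨(f i.succ : ℕ) + g i.castSucc, by
          have := (f i.succ).isLt
          have := (g i.castSucc).isLt
          omega⟩, g (Fin.last e)), Finset.mem_univ _, ?_⟩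
        rw [Fin.sum_univ_succ, Fin.sum_univ_castSucc (n := e), mul_add, Finset.mul_sum]
        simp only [F, Fin.val_zero, pow_zero, mul_one, Fin.val_succ, Fin.val_castSucc,
          Fin.val_last, Nat.cast_add, add_mul, Finset.sum_add_distrib]
        have hshift : ∑ i : Fin e, (K : ℝ) * (((g i.castSucc : ℕ) : ℝ) * (K : ℝ) ^ (i : ℕ))
            = ∑ i : Fin e, ((g i.castSucc : ℕ) : ℝ) * (K : ℝ) ^ ((i : ℕ) + 1) :=
          Finset.sum_congr rfl fun i _ => by ring
        rw [hshift]
        ring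
    _ ≤ N * ((2 * N) ^ e * N) := Finset.card_image_le.trans (by simp)
    _ = 2 ^ e * N ^ (e + 1 + 1) := by ring
    _ ≤ 2 ^ (e + 1) * N ^ (e + 1 + 1) := by gcongr <;> omega
end
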